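/- arXiv:2301.13557 — 14 statements merged into one kernel-verified Lean document; each statement's English description precedes it below -/
import Mathlib

section
/- For all integers p, q, r with 2 ≤ p ≤ q ≤ r, except when p = q = 2 and r > 2, there exists a finite connected simple graph G with chromatic number χ(G) = p, locating chromatic number χ_L(G) = q, and neighbor-locating chromatic number χ_NL(G) = r. -/
open SimpleGraph

/-- The set of colors appearing in the neighborhood of `x`. -/
def colorNbrs {V : Type*} (G : SimpleGraph V) {k : ℕ} (f : V → Fin k) (x : V) : Set (Fin k) :=
  {c | ∃ y, G.Adj x y ∧ f y = c}

/-- `f` is a neighbor-locating `k`-coloring of `G`. -/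
def IsNLColoring {V : Type*} (G : SimpleGraph V) (k : ℕ) (f : V → Fin k) : Prop :=
  (∀ u v, G.Adj u v → f u ≠ f v) ∧
  ∀ u v, u ≠ v → f u = f v → colorNbrs G f u ≠ colorNbrs G f v

/-- The neighbor-locating chromatic number. -/
noncomputable def nlChrom {V : Type*} (G : SimpleGraph V) : ℕ :=
  sInf {k | ∃ f : V → Fin k, IsNLColoring G k f}

/-- Distance from `x` to the color class of `c`. -/
noncomputable def distToClass {V : Type*} (G : SimpleGraph V) {k : ℕ} (f : V → Fin k)
    (x : V) (c : Fin k) : ℕ :=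
  sInf {n | ∃ y, f y = c ∧ G.dist x y = n}

/-- `f` is a locating `k`-coloring of `G`. -/
def IsLColoring {V : Type*} (G : SimpleGraph V) (k : ℕ) (f : V → Fin k) : Prop :=
  (∀ u v, G.Adj u v → f u ≠ f v) ∧
  ∀ u v, u ≠ v → f u = f v → ∃ c : Fin k, distToClass G f u c ≠ distToClass G f v c

/-- The locating chromatic number. -/
noncomputable def lChrom {V : Type*} (G : SimpleGraph V) : ℕ :=
  sInf {k | ∃ f : V → Fin k, IsLColoring G k f}

theorem nl_sep {V : Type*} (G : SimpleGraph V) (hG : G.Connected) (k : ℕ) (f : V → Fin k)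
    (hprop : ∀ u v, G.Adj u v → f u ≠ f v) (u v : V) (c : Fin k)
    (hu : c ∈ colorNbrs G f u) (hv : c ∉ colorNbrs G f v) :
    distToClass G f u c ≠ distToClass G f v c := by
  obtain ⟨y, hy, hyc⟩ := hu
  have hne : f u ≠ c := hyc ▸ hprop u y hy
  intro heq
  have h1 : distToClass G f u c ≤ 1 :=
    Nat.sInf_le ⟨y, hyc, by rw [SimpleGraph.dist_eq_one_iff_adj]; exact hy⟩
  have hm1 : distToClass G f u c ∈ {n | ∃ y, f y = c ∧ G.dist u y = n} :=
    Nat.sInf_mem ⟨_, y, hyc, rfl⟩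
  have hm2 : distToClass G f v c ∈ {n | ∃ y, f y = c ∧ G.dist v y = n} :=
    Nat.sInf_mem ⟨_, y, hyc, rfl⟩
  obtain ⟨y1, hy1, hd1⟩ := hm1
  obtain ⟨y2, hy2, hd2⟩ := hm2
  have hreach : G.dist u y1 ≠ 0 := by
    intro h0
    rw [hG.dist_eq_zero_iff] at h0
    exact hne (h0 ▸ hy1)
  have : G.dist v y2 = 1 := by omega
  rw [SimpleGraph.dist_eq_one_iff_adj] at this
  exact hv ⟨y2, this, hy2⟩

theorem l_of_nl {V : Type*} (G : SimpleGraph V) (hG : G.Connected) (k : ℕ) (f : V → Fin k)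
    (h : IsNLColoring G k f) : IsLColoring G k f := by
  refine ⟨h.1, fun u v huv hf => ?_⟩
  have hne := h.2 u v huv hf
  by_contra! hcon
  apply hne
  ext c
  constructor
  · intro hu
    by_contra hv
    exact nl_sep G hG k f h.1 u v c hu hv (hcon c)
  · intro hu
    by_contra hv
    exact nl_sep G hG k f h.1 v u c hu hv (hcon c).symm

theorem l_le_nl {N : ℕ} (G : SimpleGraph (Fin N)) (hG : G.Connected) : lChrom G ≤ nlChrom G := by
  have hm : nlChrom G ∈ {k | ∃ f : Fin N → Fin k, IsNLColoring G k f} :=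
    Nat.sInf_mem ⟨N, id, fun u v h => h.ne, fun u v h h' => absurd h' h⟩
  obtain ⟨f, hf⟩ := hm
  exact Nat.sInf_le ⟨f, l_of_nl G hG _ f hf⟩

theorem nl_mem {N : ℕ} (G : SimpleGraph (Fin N)) :
    ∃ f : Fin N → Fin (nlChrom G), IsNLColoring G _ f :=
  Nat.sInf_mem (s := {k | ∃ f : Fin N → Fin k, IsNLColoring G k f})
    ⟨N, id, fun _ _ h => h.ne, fun _ _ h h' => absurd h' h⟩

theorem nl_card {N : ℕ} (G : SimpleGraph (Fin N)) : N ≤ nlChrom G * 2 ^ nlChrom G := by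
  obtain ⟨f, hf⟩ := nl_mem G
  have hinj : Function.Injective (fun v => (f v, colorNbrs G f v)) := by
    intro u v h
    simp only [Prod.mk.injEq] at h
    by_contra hne
    exact hf.2 u v hne h.1 h.2
  classical
  have := Fintype.card_le_of_injective _ hinj
  simpa [Fintype.card_prod, Fintype.card_set] using this

/-- distance from a potential function -/
theorem dist_pot {V : Type*} (G : SimpleGraph V) (z : V) (h : V → ℕ)
    (hz : ∀ u, h u = 0 ↔ u = z) (hl : ∀ u v, G.Adj u v → h u ≤ h v + 1)
    (hd : ∀ u, h u ≠ 0 → ∃ v, G.Adj u v ∧ h v + 1 = h u) :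
    G.Connected ∧ ∀ u, G.dist u z = h u := by
  have hw : ∀ n u, h u = n → ∃ w : G.Walk u z, w.length = n := by
    intro n
    induction n with
    | zero =>
      intro u hu
      obtain rfl := (hz u).1 hu
      exact ⟨Walk.nil, rfl⟩
    | succ n ih =>
      intro u hu
      obtain ⟨v, hv, hv'⟩ := hd u (by omega)
      obtain ⟨w, hw⟩ := ih v (by omega)
      exact ⟨Walk.cons hv w, by simp [hw]⟩
  have hlow : ∀ u v (w : G.Walk u v), h u ≤ h v + w.length := by
    intro u v w
    induction w with
    | nil => simp
    | cons hadj w ih =>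
      have := hl _ _ hadj
      simp only [Walk.length_cons]
      omega
  have hconn : G.Connected := by
    have : Nonempty V := ⟨z⟩
    refine ⟨fun u v => ?_⟩
    obtain ⟨w, _⟩ := hw _ u rfl
    obtain ⟨w', _⟩ := hw _ v rfl
    exact ⟨w.append w'.reverse⟩
  refine ⟨hconn, fun u => le_antisymm ?_ ?_⟩
  · obtain ⟨w, h1⟩ := hw _ u rfl
    rw [← h1]
    exact dist_le w
  · obtain ⟨w, h1⟩ := hconn.exists_walk_length_eq_dist u z
    have := hlow _ _ w
    rw [(hz z).2 rfl] at this
    omega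

theorem twin_le {V : Type*} (G : SimpleGraph V) (hG : G.Connected) (a b y : V)
    (hab : ∀ w, G.Adj b w → G.Adj a w) (hy : y ≠ b) : G.dist a y ≤ G.dist b y := by
  obtain ⟨w, hw⟩ := hG.exists_walk_length_eq_dist b y
  rw [← hw]
  cases w with
  | nil => exact absurd rfl hy
  | cons h w => exact dist_le (Walk.cons (hab _ h) w)

theorem twin_ne {V : Type*} (G : SimpleGraph V) (hG : G.Connected) (k : ℕ) (f : V → Fin k)
    (hf : IsLColoring G k f) (a b : V) (hne : a ≠ b)
    (hab : ∀ w, G.Adj b w ↔ G.Adj a w) : f a ≠ f b := by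
  intro h
  obtain ⟨c, hc⟩ := hf.2 a b hne h
  apply hc
  by_cases hca : f a = c
  · have h1 : distToClass G f a c ≤ 0 := Nat.sInf_le ⟨a, hca, by simp⟩
    have h2 : distToClass G f b c ≤ 0 := Nat.sInf_le ⟨b, h ▸ hca, by simp⟩
    omega
  · unfold distToClass
    congr 1
    ext n
    have key : ∀ y, f y = c → G.dist a y = G.dist b y := by
      intro y hy
      apply le_antisymm
      · exact twin_le G hG a b y (fun w => (hab w).1) (by rintro rfl; exact hca (h.trans hy))
      · exact twin_le G hG b a y (fun w => (hab w).2) (by rintro rfl; exact hca hy)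
    constructor
    · rintro ⟨y, hy, hn⟩
      exact ⟨y, hy, by rw [← key y hy]; exact hn⟩
    · rintro ⟨y, hy, hn⟩
      exact ⟨y, hy, by rw [key y hy]; exact hn⟩

/-- oriented adjacency -/
def relA (p q a b : ℕ) : Prop :=
  a < b ∧ (b < p ∨ (a = 0 ∧ b < p + q - 1) ∨ (a = 1 ∧ b = p + q - 1) ∨
    (p + q - 1 ≤ a ∧ b = a + 1))

def gph (p q N : ℕ) : SimpleGraph (Fin N) where
  Adj a b := relA p q a b ∨ relA p q b a
  symm := ⟨fun _ _ h => h.symm⟩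
  loopless := ⟨fun a h => by unfold relA at h; omega⟩

def hpot (p q v : ℕ) : ℕ :=
  if v = 0 then 0 else if v < p + q - 1 then 1 else v - (p + q - 1) + 2

def colQ (p q v : ℕ) : ℕ :=
  if v < p then v else if v < p + q - 1 then v - (p - 1) else 2 - (v - (p + q - 1)) % 2

def colP (p q v : ℕ) : ℕ :=
  if v < p then v else if v < p + q - 1 then 1 else (v - (p + q - 1)) % 2

theorem gph_pot (p q N : ℕ) (hp : 2 ≤ p) (hq : 3 ≤ q) (hN : p + q ≤ N) :
    (gph p q N).Connected ∧ ∀ u, (gph p q N).dist u ⟨0, by omega⟩ = hpot p q u := by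
  apply dist_pot
  · intro u
    rw [Fin.ext_iff]
    unfold hpot
    show _ ↔ (u : ℕ) = 0
    split_ifs <;> simp <;> omega
  · intro u v h
    simp only [gph, relA] at h
    unfold hpot
    split_ifs <;> omega
  · intro u hu
    by_cases h1 : (u : ℕ) < p + q - 1
    · refine ⟨⟨0, by omega⟩, ?_⟩
      simp only [gph, relA]
      unfold hpot at *
      simp only [h1, if_true] at *
      split_ifs at * <;> simp at * <;> omega
    · by_cases h2 : (u : ℕ) = p + q - 1
      · refine ⟨⟨1, by omega⟩, ?_⟩
        simp only [gph, relA]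
        unfold hpot at *
        try simp only at *
        split_ifs at * <;> (try simp only [true_and, and_true, false_and, and_false, false_or, or_false]) <;> omega
      · refine ⟨⟨u - 1, by omega⟩, ?_⟩
        simp only [gph, relA]
        unfold hpot at *
        try simp only at *
        split_ifs at * <;> omega

theorem gph_chrom (p q N : ℕ) (hp : 2 ≤ p) (hq : 3 ≤ q) (hN : p + q ≤ N) :
    (gph p q N).chromaticNumber = (p : ℕ∞) := by
  apply le_antisymm
  · apply SimpleGraph.Colorable.chromaticNumber_le
    refine ⟨SimpleGraph.Coloring.mk
      (fun v : Fin N => (⟨colP p q v, by unfold colP; split_ifs <;> omega⟩ : Fin p)) ?_⟩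
    intro u v h h'
    simp only [gph, relA] at h
    rw [Fin.mk.injEq] at h'
    unfold colP at h'
    split_ifs at h' <;> omega
  · have hc : (gph p q N).IsClique
        ((Finset.univ.map (Fin.castLEEmb (show p ≤ N by omega)) : Finset (Fin N)) : Set (Fin N)) := by
      intro a ha b hb hab
      simp only [Finset.coe_map, Finset.coe_univ, Set.image_univ, Set.mem_range] at ha hb
      obtain ⟨a', rfl⟩ := ha
      obtain ⟨b', rfl⟩ := hb
      simp [Fin.ext_iff] at hab
      simp only [gph, relA, Fin.castLEEmb_apply, Fin.val_castLE]
      omega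
    simpa using hc.card_le_chromaticNumber

def colF (p q N : ℕ) (hp : 2 ≤ p) (hpq : p ≤ q) (hq : 3 ≤ q) (v : Fin N) : Fin q :=
  ⟨colQ p q v, by unfold colQ; split_ifs <;> omega⟩

theorem colF_proper (p q N : ℕ) (hp : 2 ≤ p) (hpq : p ≤ q) (hq : 3 ≤ q) (u v : Fin N)
    (h : (gph p q N).Adj u v) : colF p q N hp hpq hq u ≠ colF p q N hp hpq hq v := by
  intro h'
  simp only [gph, relA] at h
  simp only [colF, Fin.mk.injEq] at h'
  unfold colQ at h'
  split_ifs at h' <;> omega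

theorem colF_zero (p q N : ℕ) (hp : 2 ≤ p) (hpq : p ≤ q) (hq : 3 ≤ q) (u : Fin N) :
    colF p q N hp hpq hq u = ⟨0, by omega⟩ ↔ (u : ℕ) = 0 := by
  simp only [colF, Fin.mk.injEq]
  unfold colQ
  split_ifs <;> omega

theorem colF_sep1 (p q N : ℕ) (hp : 2 ≤ p) (hpq : p ≤ q) (hq : 3 ≤ q) (hN : p + q ≤ N)
    (u v : Fin N) (huv : u < v) (hf : colF p q N hp hpq hq u = colF p q N hp hpq hq v)
    (hh : hpot p q u = hpot p q v) :
    colorNbrs (gph p q N) (colF p q N hp hpq hq) u ≠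
      colorNbrs (gph p q N) (colF p q N hp hpq hq) v := by
  have huv' : (u : ℕ) < v := huv
  have h1 : 0 < (u : ℕ) ∧ (u : ℕ) < p ∧ (v : ℕ) = u + (p - 1) := by
    simp only [colF, Fin.mk.injEq] at hf
    unfold colQ at hf
    unfold hpot at hh
    split_ifs at hf hh <;> omega
  obtain ⟨h0, h1, h2⟩ := h1
  have hv : ∀ c ∈ colorNbrs (gph p q N) (colF p q N hp hpq hq) v, (c : ℕ) = 0 := by
    rintro c ⟨y, hy, rfl⟩
    have : (y : ℕ) = 0 := by
      simp only [gph, relA] at hy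
      omega
    rw [(colF_zero p q N hp hpq hq y).2 this]
  intro heq
  by_cases hu1 : (u : ℕ) = 1
  · have : (⟨2, by omega⟩ : Fin q) ∈ colorNbrs (gph p q N) (colF p q N hp hpq hq) u := by
      refine ⟨⟨p + q - 1, by omega⟩, ?_, ?_⟩
      · simp only [gph, relA]; (try simp only [true_and, and_true, false_and, and_false, false_or, or_false]) <;> omega
      · simp only [colF, Fin.mk.injEq]
        unfold colQ
        split_ifs <;> omega
    rw [heq] at this
    have := hv _ this
    simp at this
  · have : (⟨1, by omega⟩ : Fin q) ∈ colorNbrs (gph p q N) (colF p q N hp hpq hq) u := by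
      refine ⟨⟨1, by omega⟩, ?_, ?_⟩
      · simp only [gph, relA]; omega
      · simp only [colF, Fin.mk.injEq]
        unfold colQ
        split_ifs <;> omega
    rw [heq] at this
    have := hv _ this
    simp at this

theorem colF_sep (p q N : ℕ) (hp : 2 ≤ p) (hpq : p ≤ q) (hq : 3 ≤ q) (hN : p + q ≤ N)
    (u v : Fin N) (huv : u ≠ v) (hf : colF p q N hp hpq hq u = colF p q N hp hpq hq v)
    (hh : hpot p q u = hpot p q v) :
    colorNbrs (gph p q N) (colF p q N hp hpq hq) u ≠
      colorNbrs (gph p q N) (colF p q N hp hpq hq) v := by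
  rcases lt_or_gt_of_ne huv with h | h
  · exact colF_sep1 p q N hp hpq hq hN u v h hf hh
  · exact (colF_sep1 p q N hp hpq hq hN v u h hf.symm hh.symm).symm

theorem colF_L (p q N : ℕ) (hp : 2 ≤ p) (hpq : p ≤ q) (hq : 3 ≤ q) (hN : p + q ≤ N) :
    IsLColoring (gph p q N) q (colF p q N hp hpq hq) := by
  obtain ⟨hG, hdist⟩ := gph_pot p q N hp hq hN
  refine ⟨colF_proper p q N hp hpq hq, fun u v huv hf => ?_⟩
  by_cases hh : hpot p q u = hpot p q v
  · have hne := colF_sep p q N hp hpq hq hN u v huv hf hh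
    by_contra! hcon
    apply hne
    ext c
    constructor
    · intro hu
      by_contra hv
      exact nl_sep _ hG q _ (colF_proper p q N hp hpq hq) u v c hu hv (hcon c)
    · intro hu
      by_contra hv
      exact nl_sep _ hG q _ (colF_proper p q N hp hpq hq) v u c hu hv (hcon c).symm
  · refine ⟨⟨0, by omega⟩, ?_⟩
    have key : ∀ w, distToClass (gph p q N) (colF p q N hp hpq hq) w ⟨0, by omega⟩
        = hpot p q w := by
      intro w
      have : {n | ∃ y, colF p q N hp hpq hq y = ⟨0, by omega⟩ ∧ (gph p q N).dist w y = n}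
          = {hpot p q w} := by
        ext n
        simp only [Set.mem_ofPred_eq, Set.mem_singleton_iff]
        constructor
        · rintro ⟨y, hy, rfl⟩
          rw [colF_zero] at hy
          have : y = ⟨0, by omega⟩ := Fin.ext hy
          rw [this, hdist]
        · rintro rfl
          exact ⟨⟨0, by omega⟩, (colF_zero p q N hp hpq hq _).2 rfl, hdist w⟩
      unfold distToClass
      rw [this, csInf_singleton]
    rw [key, key]
    exact hh

theorem gph_l (p q N : ℕ) (hp : 2 ≤ p) (hpq : p ≤ q) (hq : 3 ≤ q) (hN : p + q ≤ N) :
    lChrom (gph p q N) = q := by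
  obtain ⟨hG, -⟩ := gph_pot p q N hp hq hN
  apply le_antisymm
  · exact Nat.sInf_le ⟨_, colF_L p q N hp hpq hq hN⟩
  · refine le_csInf ⟨q, _, colF_L p q N hp hpq hq hN⟩ ?_
    rintro k ⟨f, hf⟩
    let g : Fin q → Fin k := fun i =>
      f ⟨if (i : ℕ) = 0 then 0 else p - 1 + i, by split_ifs <;> omega⟩
    have hg : Function.Injective g := by
      have hlt : ∀ i j, i < j → g i ≠ g j := by
        intro i j hij
        have hij' : (i : ℕ) < j := hij
        by_cases hi : (i : ℕ) = 0
        · apply hf.1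
          simp only [gph, relA, hi, if_true]
          split_ifs <;> (try simp only [true_and, and_true, false_and, and_false, false_or, or_false]) <;> omega
        · apply twin_ne _ hG k f hf
          · simp only [ne_eq, Fin.mk.injEq]
            split_ifs <;> omega
          · intro w
            simp only [gph, relA]
            split_ifs <;> omega
      intro i j hij
      rcases lt_trichotomy i j with h | h | h
      · exact absurd hij (hlt _ _ h)
      · exact h
      · exact absurd hij.symm (hlt _ _ h)
    simpa using Fintype.card_le_of_injective g hg

theorem gph_nl_base (p q : ℕ) (hp : 2 ≤ p) (hpq : p ≤ q) (hq : 3 ≤ q) :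
    nlChrom (gph p q (p + q)) ≤ q := by
  refine Nat.sInf_le ⟨colF p q _ hp hpq hq, colF_proper p q _ hp hpq hq, fun u v huv hf => ?_⟩
  by_cases hh : hpot p q u = hpot p q v
  · exact colF_sep p q _ hp hpq hq le_rfl u v huv hf hh
  · have hz : ∀ w : Fin (p + q), (w : ℕ) ≠ 0 →
        ((⟨0, by omega⟩ : Fin q) ∈ colorNbrs (gph p q _) (colF p q _ hp hpq hq) w ↔
          (w : ℕ) < p + q - 1) := by
      intro w hw
      constructor
      · rintro ⟨y, hy, hy0⟩
        rw [colF_zero] at hy0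
        simp only [gph, relA] at hy
        omega
      · intro h
        refine ⟨⟨0, by omega⟩, ?_, (colF_zero p q _ hp hpq hq _).2 rfl⟩
        simp only [gph, relA]
        (try simp only [true_and, and_true, false_and, and_false, false_or, or_false]) <;> omega
    have hu0 : (u : ℕ) ≠ 0 := by
      intro h
      have h' := (colF_zero p q _ hp hpq hq u).2 h
      rw [hf, colF_zero] at h'
      exact huv (Fin.ext (h.trans h'.symm))
    have hv0 : (v : ℕ) ≠ 0 := by
      intro h
      have h' := (colF_zero p q _ hp hpq hq v).2 h
      rw [← hf, colF_zero] at h'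
      exact huv (Fin.ext (h'.trans h.symm))
    intro heq
    have := hz u hu0
    rw [heq, hz v hv0] at this
    unfold hpot at hh
    split_ifs at hh <;> omega

theorem gph_nl_step (p q N : ℕ) (hp : 2 ≤ p) (hq : 3 ≤ q) (hN : p + q ≤ N) :
    nlChrom (gph p q (N + 1)) ≤ nlChrom (gph p q N) + 1 := by
  obtain ⟨f, hf⟩ := nl_mem (gph p q N)
  generalize nlChrom (gph p q N) = k at f hf
  let g : Fin (N + 1) → Fin (k + 1) := Fin.lastCases (Fin.last k) (fun i => (f i).castSucc)
  have gl : g (Fin.last N) = Fin.last k := by simp [g]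
  have gc : ∀ i : Fin N, g i.castSucc = (f i).castSucc := by intro i; simp [g]
  have adjc : ∀ i j : Fin N, (gph p q (N + 1)).Adj i.castSucc j.castSucc ↔ (gph p q N).Adj i j := by
    intro i j; simp [gph]
  have hnb : ∀ (i : Fin N) (c : Fin k),
      c.castSucc ∈ colorNbrs (gph p q (N + 1)) g i.castSucc ↔ c ∈ colorNbrs (gph p q N) f i := by
    intro i c
    constructor
    · rintro ⟨y, hy, hyc⟩
      induction y using Fin.lastCases with
      | last => rw [gl] at hyc; exact absurd hyc.symm (Fin.castSucc_lt_last c).ne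
      | cast j =>
        rw [gc] at hyc
        exact ⟨j, (adjc i j).1 hy, Fin.castSucc_injective _ hyc⟩
    · rintro ⟨y, hy, rfl⟩
      exact ⟨y.castSucc, (adjc i y).2 hy, gc y⟩
  refine Nat.sInf_le ⟨g, ?_, ?_⟩
  · intro u v h
    induction u using Fin.lastCases with
    | last =>
      induction v using Fin.lastCases with
      | last => exact absurd h (SimpleGraph.irrefl _)
      | cast j => rw [gl, gc]; exact (Fin.castSucc_lt_last _).ne'
    | cast i =>
      induction v using Fin.lastCases with
      | last => rw [gl, gc]; exact (Fin.castSucc_lt_last _).ne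
      | cast j =>
        rw [gc, gc]
        intro h'
        exact hf.1 i j ((adjc i j).1 h) (Fin.castSucc_injective _ h')
  · intro u v huv h
    induction u using Fin.lastCases with
    | last =>
      induction v using Fin.lastCases with
      | last => exact absurd rfl huv
      | cast j => rw [gl, gc] at h; exact absurd h (Fin.castSucc_lt_last _).ne'
    | cast i =>
      induction v using Fin.lastCases with
      | last => rw [gl, gc] at h; exact absurd h (Fin.castSucc_lt_last _).ne
      | cast j =>
        rw [gc, gc] at h
        intro heq
        refine hf.2 i j (by rintro rfl; exact huv rfl) (Fin.castSucc_injective _ h) ?_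
        ext c
        rw [← hnb, ← hnb, heq]

theorem ivt_nat (g : ℕ → ℕ) (r : ℕ) (h0 : g 0 ≤ r) (hs : ∀ n, g (n + 1) ≤ g n + 1)
    (hu : ∃ n, r ≤ g n) : ∃ n, g n = r := by
  classical
  refine ⟨Nat.find hu, le_antisymm ?_ (Nat.find_spec hu)⟩
  rcases hm : Nat.find hu with _ | m
  · exact h0
  · have := Nat.find_min hu (m := m) (by omega)
    have := hs m
    omega

theorem case_two : (⊤ : SimpleGraph (Fin 2)).Connected ∧
    (⊤ : SimpleGraph (Fin 2)).chromaticNumber = (2 : ℕ∞) ∧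
    lChrom (⊤ : SimpleGraph (Fin 2)) = 2 ∧ nlChrom (⊤ : SimpleGraph (Fin 2)) = 2 := by
  have hG : (⊤ : SimpleGraph (Fin 2)).Connected := SimpleGraph.connected_top
  have h1 : nlChrom (⊤ : SimpleGraph (Fin 2)) ≤ 2 :=
    Nat.sInf_le ⟨id, fun u v h => h.ne, fun u v h h' => absurd h' h⟩
  have h2 := l_le_nl _ hG
  have h3 : 2 ≤ lChrom (⊤ : SimpleGraph (Fin 2)) := by
    refine le_csInf ⟨2, id, fun u v h => h.ne, fun u v h h' => absurd h' h⟩ ?_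
    rintro k ⟨f, hf⟩
    have hinj : Function.Injective f := by
      intro a b hab
      by_contra hne
      exact hf.1 a b hne hab
    simpa using Fintype.card_le_of_injective f hinj
  refine ⟨hG, ?_, by omega, by omega⟩
  rw [SimpleGraph.chromaticNumber_top]
  simp

theorem stmt0 (p q r : ℕ) (hp : 2 ≤ p) (hpq : p ≤ q) (hqr : q ≤ r)
    (hexc : ¬ (p = 2 ∧ q = 2 ∧ 2 < r)) :
    ∃ (V : Type) (_ : Fintype V) (G : SimpleGraph V),
      G.Connected ∧ G.chromaticNumber = (p : ℕ∞) ∧ lChrom G = q ∧ nlChrom G = r := by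
  by_cases hq : 3 ≤ q
  · obtain ⟨n, hn⟩ := ivt_nat (fun n => nlChrom (gph p q (p + q + n))) r
      ((gph_nl_base p q hp hpq hq).trans hqr)
      (fun n => gph_nl_step p q (p + q + n) hp hq (by omega))
      (by
        refine ⟨r * 2 ^ r, ?_⟩
        by_contra! h
        have h1 := nl_card (gph p q (p + q + r * 2 ^ r))
        have h2 : nlChrom (gph p q (p + q + r * 2 ^ r)) * 2 ^ nlChrom (gph p q (p + q + r * 2 ^ r))
            ≤ r * 2 ^ r := Nat.mul_le_mul h.le (Nat.pow_le_pow_right (by norm_num) h.le)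
        omega)
    exact ⟨Fin (p + q + n), inferInstance, gph p q (p + q + n),
      (gph_pot p q _ hp hq (by omega)).1, gph_chrom p q _ hp hq (by omega),
      gph_l p q _ hp hpq hq (by omega), hn⟩
  · obtain rfl : p = 2 := by omega
    obtain rfl : q = 2 := by omega
    obtain rfl : r = 2 := by omega
    exact ⟨Fin 2, inferInstance, ⊤, by exact_mod_cast case_two⟩
end

section
/- For every integer k ≥ 0, there exists a finite connected simple graph G_k having an induced subgraph H_k such that χ_L(H_k) − χ_L(G_k) = k and χ_NL(H_k) − χ_NL(G_k) = k. -/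
open SimpleGraph

theorem dtc_one {V : Type*} (G : SimpleGraph V) (hG : G.Connected) {k : ℕ} (f : V → Fin k)
    (hp : ∀ u v, G.Adj u v → f u ≠ f v) (x : V) (c : Fin k) :
    distToClass G f x c = 1 ↔ c ∈ colorNbrs G f x := by
  unfold distToClass colorNbrs
  constructor
  · intro h
    have hm := Nat.sInf_mem (Nat.nonempty_of_sInf_eq_succ h)
    rw [h] at hm
    obtain ⟨y, hy, hd⟩ := hm
    exact ⟨y, SimpleGraph.dist_eq_one_iff_adj.1 hd, hy⟩
  · rintro ⟨y, ha, hy⟩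
    have h1 : (1 : ℕ) ∈ {n | ∃ y, f y = c ∧ G.dist x y = n} :=
      ⟨y, hy, SimpleGraph.dist_eq_one_iff_adj.2 ha⟩
    have hle := Nat.sInf_le h1
    have hm := Nat.sInf_mem ⟨1, h1⟩
    obtain ⟨z, hz, hd⟩ := hm
    by_contra hne
    have h0 : sInf {n | ∃ y, f y = c ∧ G.dist x y = n} = 0 := by omega
    rw [h0] at hd
    have := hG.dist_eq_zero_iff.1 hd
    subst this
    exact hp _ _ ha (hz.trans hy.symm)

theorem nl_to_l {V : Type*} (G : SimpleGraph V) (hG : G.Connected) {k : ℕ} (f : V → Fin k)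
    (h : IsNLColoring G k f) : IsLColoring G k f := by
  refine ⟨h.1, fun u v huv hf => ?_⟩
  by_contra! hc
  apply h.2 u v huv hf
  ext c
  rw [← dtc_one G hG f h.1, ← dtc_one G hG f h.1, hc]

theorem sInf_eq_of {S : Set ℕ} {n : ℕ} (h : n ∈ S) (h2 : ∀ m ∈ S, n ≤ m) : sInf S = n :=
  le_antisymm (Nat.sInf_le h) (le_csInf ⟨n, h⟩ h2)

theorem bot_chrom {W : Type*} [Fintype W] (H : SimpleGraph W) (hH : ∀ u v, ¬ H.Adj u v) :
    lChrom H = Fintype.card W ∧ nlChrom H = Fintype.card W := by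
  have hb : H = ⊥ := by ext u v; simp [hH]
  subst hb
  let e := Fintype.equivFin W
  have key : ∀ m (f : W → Fin m), Function.Injective f → Fintype.card W ≤ m := by
    intro m f hf
    simpa using Fintype.card_le_of_injective f hf
  constructor
  · refine sInf_eq_of ⟨e, by simp, fun u v h h' => absurd (e.injective h') h⟩ ?_
    rintro m ⟨f, -, hf⟩
    refine key m f fun u v h => ?_
    by_contra hne
    obtain ⟨c, hc⟩ := hf u v hne h
    apply hc
    simp [distToClass, SimpleGraph.dist_bot]
  · refine sInf_eq_of ⟨e, by simp, fun u v h h' => absurd (e.injective h') h⟩ ?_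
    rintro m ⟨f, -, hf⟩
    refine key m f fun u v h => ?_
    by_contra hne
    apply hf u v hne h
    simp [colorNbrs]

/-- Clique with `n - 1` leaves at each vertex. -/
def GG (n : ℕ) : SimpleGraph (Fin n × Fin n) where
  Adj p q := p ≠ q ∧ ((p.1 = p.2 ∧ q.1 = q.2) ∨ (p.1 = q.1 ∧ (p.1 = p.2 ∨ q.1 = q.2)))
  symm := ⟨by
    rintro p q ⟨h, h'⟩
    refine ⟨h.symm, ?_⟩
    grind⟩
  loopless := ⟨fun p h => h.1 rfl⟩

theorem GG_conn (n : ℕ) : (GG (n+1)).Connected := by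
  have hd : ∀ i j : Fin (n+1), (GG (n+1)).Reachable (i,i) (j,j) := by
    intro i j
    by_cases h : i = j
    · subst h; rfl
    · exact SimpleGraph.Adj.reachable ⟨by simp [h], Or.inl ⟨rfl, rfl⟩⟩
  have h1 : ∀ p : Fin (n+1) × Fin (n+1), (GG (n+1)).Reachable p (p.1, p.1) := by
    rintro ⟨i, j⟩
    by_cases h : i = j
    · subst h; rfl
    · exact SimpleGraph.Adj.reachable ⟨by simp [Ne.symm h], Or.inr ⟨rfl, Or.inr rfl⟩⟩
  have : Nonempty (Fin (n+1) × Fin (n+1)) := ⟨(0, 0)⟩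
  exact ⟨fun p q => (h1 p).trans ((hd _ _).trans (h1 q).symm)⟩

theorem GG_nl (k : ℕ) : IsNLColoring (GG (k+3)) (k+3) Prod.snd := by
  have hoff : ∀ i j : Fin (k+3), i ≠ j → colorNbrs (GG (k+3)) Prod.snd (i, j) = {i} := by
    intro i j hij
    ext c
    simp only [colorNbrs, Set.mem_ofPred_eq, Set.mem_singleton_iff]
    constructor
    · rintro ⟨⟨a, b⟩, ⟨h1, h2⟩, rfl⟩
      grind
    · rintro rfl
      exact ⟨(c, c), ⟨by simp [Ne.symm hij], Or.inr ⟨rfl, Or.inr rfl⟩⟩, rfl⟩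
  have hdi : ∀ j c : Fin (k+3), c ≠ j → c ∈ colorNbrs (GG (k+3)) Prod.snd (j, j) := by
    intro j c h
    exact ⟨(c, c), ⟨by simp [Ne.symm h], Or.inl ⟨rfl, rfl⟩⟩, rfl⟩
  have hne : ∀ i j : Fin (k+3), i ≠ j → 
      colorNbrs (GG (k+3)) Prod.snd (i, j) ≠ colorNbrs (GG (k+3)) Prod.snd (j, j) := by
    intro i j hij h
    rw [hoff i j hij] at h
    obtain ⟨c, hc⟩ : ∃ c, c ∉ ({i, j} : Finset (Fin (k+3))) := by
      by_contra! hc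
      have := Finset.card_le_card (fun x _ => hc x : (Finset.univ : Finset (Fin (k+3))) ⊆ {i, j})
      have := Finset.card_le_two (a := i) (b := j)
      simp at *
      omega
    simp at hc
    have := hdi j c hc.2
    rw [← h] at this
    exact hc.1 this
  constructor
  · rintro ⟨a, b⟩ ⟨c, d⟩ ⟨h1, h2⟩ h
    grind
  · rintro ⟨a, b⟩ ⟨c, d⟩ h1 h2
    simp only at h2
    subst h2
    by_cases ha : a = b
    · subst ha
      exact (hne c a (by grind)).symm
    · by_cases hc : c = b
      · subst hc
        exact hne a c ha
      · rw [hoff _ _ ha, hoff _ _ hc]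
        intro h
        rw [Set.singleton_eq_singleton_iff] at h
        exact h1 (by rw [h])

theorem GG_lower (n m : ℕ) (f : Fin n × Fin n → Fin m)
    (hf : ∀ u v, (GG n).Adj u v → f u ≠ f v) : n ≤ m := by
  have : Function.Injective fun i : Fin n => f (i, i) := by
    intro i j h
    by_contra hne
    exact hf (i, i) (j, j) ⟨by simp [hne], Or.inl ⟨rfl, rfl⟩⟩ h
  simpa using Fintype.card_le_of_injective _ this

/-- Theorem 2: for every `k ≥ 0` there exist a finite connected graph `G` and an induced
subgraph `H` of `G` with `χ_L(H) - χ_L(G) = k` and `χ_NL(H) - χ_NL(G) = k`. -/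
theorem stmt1 (k : ℕ) :
    ∃ (V : Type) (_ : Fintype V) (G : SimpleGraph V) (s : Set V),
      G.Connected ∧
      lChrom (G.induce s) = lChrom G + k ∧
      nlChrom (G.induce s) = nlChrom G + k := by
  have hl : lChrom (GG (k+3)) = k+3 :=
    sInf_eq_of ⟨_, nl_to_l _ (GG_conn _) _ (GG_nl k)⟩ fun m ⟨f, hf⟩ => GG_lower _ m f hf.1
  have hn : nlChrom (GG (k+3)) = k+3 :=
    sInf_eq_of ⟨_, GG_nl k⟩ fun m ⟨f, hf⟩ => GG_lower _ m f hf.1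
  obtain ⟨s, hs, hc⟩ := Finset.exists_subset_card_eq
    (s := (Finset.univ : Finset (Fin (k+3))).offDiag) (n := k + 3 + k) (by
      rw [Finset.offDiag_card]
      simp only [Finset.card_univ, Fintype.card_fin]
      apply Nat.le_sub_of_add_le
      nlinarith)
  refine ⟨_, inferInstance, GG (k+3), (s : Set _), GG_conn _, ?_⟩
  rw [hl, hn]
  have := bot_chrom ((GG (k+3)).induce (s : Set (Fin (k+3) × Fin (k+3)))) (by
    rintro ⟨⟨a, b⟩, hu⟩ ⟨⟨c, d⟩, hv⟩ ⟨h1, h2⟩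
    have h3 := hs hu
    have h4 := hs hv
    simp at h2 h3 h4
    grind)
  simpa [hc] using this
end

section
/- Let G be a finite connected simple graph on n ≥ 2 vertices with neighbor-locating chromatic number k and average degree d. If k ≤ ⌈d⌉, then n < ⌈d⌉ · k^(⌈d⌉ − 1). -/
open SimpleGraph

/-- Theorem 3(i): if `G` is connected on `n ≥ 2` vertices with neighbor-locating chromatic
number `k` and average degree `d`, and `k ≤ ⌈d⌉`, then `n < ⌈d⌉ · k ^ (⌈d⌉ - 1)`. -/
theorem stmt2 {V : Type*} [Fintype V] (G : SimpleGraph V) [DecidableRel G.Adj]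
    (hconn : G.Connected) (hn : 2 ≤ Fintype.card V)
    (k a : ℕ) (hk : k = nlChrom G)
    (ha : a = ⌈(∑ v, (G.degree v : ℝ)) / (Fintype.card V : ℝ)⌉₊)
    (hka : k ≤ a) :
    Fintype.card V < a * k ^ (a - 1) := by
  classical
  have hne : {k | ∃ f : V → Fin k, IsNLColoring G k f}.Nonempty := by
    refine ⟨Fintype.card V, Fintype.equivFin V, ?_, ?_⟩
    · intro u v h e
      exact h.ne ((Fintype.equivFin V).injective e)
    · intro u v h e
      exact absurd ((Fintype.equivFin V).injective e) h
  have hmem := Nat.sInf_mem hne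
  change nlChrom G ∈ _ at hmem
  rw [← hk] at hmem
  obtain ⟨f, hf1, hf2⟩ := hmem
  haveI : Nontrivial V := Fintype.one_lt_card_iff_nontrivial.mp hn
  have hnb : ∀ v, ∃ w, G.Adj v w := fun v => hconn.preconnected.exists_adj_of_nontrivial v
  have hk2 : 2 ≤ k := by
    obtain ⟨v⟩ := hconn.nonempty
    obtain ⟨w, hw⟩ := hnb v
    have h1 := hf1 v w hw
    have h2 := (f v).isLt
    have h3 := (f w).isLt
    have h4 : (f v).val ≠ (f w).val := fun e => h1 (Fin.ext e)
    omega
  let T : Finset ((_ : Fin k) × Finset (Fin k)) :=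
    Finset.univ.sigma (fun c => ((Finset.univ.erase c).powerset.erase ∅))
  have hT : T.card = k * (2 ^ (k - 1) - 1) := by
    simp [T, Finset.card_sigma, Finset.card_erase_of_mem]
  have hle : Fintype.card V ≤ T.card := by
    rw [← Finset.card_univ]
    refine Finset.card_le_card_of_injOn (fun v => ⟨f v, (colorNbrs G f v).toFinset⟩) ?_ ?_
    · intro v _
      obtain ⟨w, hw⟩ := hnb v
      have h1 : f v ∉ colorNbrs G f v := by
        rintro ⟨y, hy, e⟩
        exact hf1 v y hy e.symm
      have h2 : f w ∈ colorNbrs G f v := ⟨w, hw, rfl⟩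
      simp only [T, Finset.coe_sigma, Set.mem_sigma_iff, Finset.mem_coe, Finset.mem_univ, true_and,
        Finset.mem_erase, Finset.mem_powerset]
      refine ⟨?_, ?_⟩
      · intro h
        have := Set.mem_toFinset.mpr h2
        rw [h] at this
        simp at this
      · intro c hc
        rw [Set.mem_toFinset] at hc
        simp only [Finset.mem_erase, Finset.mem_univ, and_true]
        rintro rfl
        exact h1 hc
    · intro u _ v _ h
      by_contra hne
      simp only [Sigma.mk.injEq, heq_eq_eq, Set.toFinset_inj] at h
      exact hf2 u v hne h.1 h.2
  have hpow : 2 ^ (k - 1) ≤ k ^ (a - 1) :=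
    (Nat.pow_le_pow_left hk2 _).trans (Nat.pow_le_pow_right (by omega) (by omega))
  have hpos : 0 < 2 ^ (k - 1) := by positivity
  calc Fintype.card V ≤ k * (2 ^ (k - 1) - 1) := hT ▸ hle
    _ < k * 2 ^ (k - 1) := Nat.mul_lt_mul_of_pos_left (by omega) (by omega)
    _ ≤ a * k ^ (a - 1) := Nat.mul_le_mul hka hpow
end

section
/- Let G be a finite connected simple graph on n ≥ 2 vertices with neighbor-locating chromatic number k and average degree d. If k ≥ ⌈d⌉ + 1, then n ≤ k · Σ_{i=1}^{⌈d⌉} (⌈d⌉ + 1 − i) · C(k−1, i), where C(k−1, i) is the binomial coefficient. -/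
open SimpleGraph

/-- Theorem 3(ii), first part: if `G` is connected on `n ≥ 2` vertices with neighbor-locating
chromatic number `k` and average degree `d`, and `k ≥ ⌈d⌉ + 1`, then
`n ≤ k · Σ_{i=1}^{⌈d⌉} (⌈d⌉ + 1 - i) · C(k-1, i)`. -/
theorem stmt3 {V : Type*} [Fintype V] (G : SimpleGraph V) [DecidableRel G.Adj]
    (hconn : G.Connected) (hn : 2 ≤ Fintype.card V)
    (k a : ℕ) (hk : k = nlChrom G)
    (ha : a = ⌈(∑ v, (G.degree v : ℝ)) / (Fintype.card V : ℝ)⌉₊)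
    (hka : a + 1 ≤ k) :
    Fintype.card V ≤ k * ∑ i ∈ Finset.Icc 1 a, (a + 1 - i) * (k - 1).choose i := by
  classical
  have hex : ∃ f : V → Fin k, IsNLColoring G k f := by
    have hne : {k | ∃ f : V → Fin k, IsNLColoring G k f}.Nonempty := by
      apply Nat.nonempty_of_pos_sInf
      have : 0 < nlChrom G := by omega
      exact this
    have h := Nat.sInf_mem hne
    have h2 : k = sInf {k | ∃ f : V → Fin k, IsNLColoring G k f} := hk
    rw [← h2] at h
    exact h
  obtain ⟨f, hprop, hloc⟩ := hex
  have hnt : Nontrivial V := Fintype.one_lt_card_iff_nontrivial.mp hn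
  let N : V → Finset (Fin k) := fun v => (G.neighborFinset v).image f
  have hNset : ∀ v, (N v : Set (Fin k)) = colorNbrs G f v := by
    intro v
    ext c
    simp [N, colorNbrs]
  have hNle : ∀ v, (N v).card ≤ G.degree v := fun v => Finset.card_image_le
  have hNpos : ∀ v, (N v).card ≠ 0 := by
    intro v
    obtain ⟨w, hw⟩ := hconn.preconnected.exists_adj_of_nontrivial v
    have : f w ∈ N v := Finset.mem_image_of_mem f (by simpa using hw)
    exact Finset.card_ne_zero_of_mem this
  have hNf : ∀ v, N v ⊆ Finset.univ.erase (f v) := by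
    intro v c hc
    simp only [N, Finset.mem_image, mem_neighborFinset] at hc
    obtain ⟨w, hw, rfl⟩ := hc
    simpa using (hprop v w hw).symm
  let g : ℕ → ℕ := fun m => if m = 0 then 0 else a + 1 - m
  have hdeg : ∑ v, G.degree v ≤ Fintype.card V * a := by
    have h1 : (∑ v, (G.degree v : ℝ)) / (Fintype.card V : ℝ) ≤ a := by
      rw [ha]; exact Nat.le_ceil _
    have hpos : (0 : ℝ) < Fintype.card V := by
      exact_mod_cast (by omega : 0 < Fintype.card V)
    rw [div_le_iff₀ hpos] at h1
    rw [mul_comm]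
    exact_mod_cast h1
  have hA : Fintype.card V ≤ ∑ v, g (N v).card := by
    have h2 : ∑ _v : V, (1 + a) ≤ ∑ v, (g (N v).card + G.degree v) := by
      apply Finset.sum_le_sum
      intro v _
      have := hNle v
      simp only [g, if_neg (hNpos v)]
      omega
    rw [Finset.sum_add_distrib, Finset.sum_add_distrib] at h2
    simp only [Finset.sum_const, Finset.card_univ, smul_eq_mul, mul_one] at h2
    omega
  have hB : ∑ v, g (N v).card ≤
      ∑ c : Fin k, ∑ S ∈ (Finset.univ.erase c).powerset, g S.card := by
    rw [Finset.sum_sigma']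
    have hinj : Set.InjOn (fun v : V => (⟨f v, N v⟩ : (_ : Fin k) × Finset (Fin k)))
        (Finset.univ : Finset V) := by
      intro u _ v _ huv
      by_contra hne
      simp only [Sigma.mk.injEq, heq_eq_eq] at huv
      apply hloc u v hne huv.1
      rw [← hNset, ← hNset, huv.2]
    have := Finset.sum_image (f := fun p : (_ : Fin k) × Finset (Fin k) => g p.2.card) hinj
    rw [← this]
    apply Finset.sum_le_sum_of_subset
    intro p hp
    obtain ⟨v, _, rfl⟩ := Finset.mem_image.mp hp
    simp only [Finset.mem_sigma, Finset.mem_univ, Finset.mem_powerset, true_and]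
    exact hNf v
  refine hA.trans (hB.trans (le_of_eq ?_))
  have hC : ∀ c : Fin k, ∑ S ∈ (Finset.univ.erase c).powerset, g S.card =
      ∑ i ∈ Finset.Icc 1 a, (a + 1 - i) * (k - 1).choose i := by
    intro c
    rw [Finset.sum_powerset_apply_card]
    have hc : (Finset.univ.erase c).card = k - 1 := by simp
    rw [hc]
    symm
    have : ∀ i ∈ Finset.Icc 1 a, (a + 1 - i) * (k - 1).choose i = (k - 1).choose i • g i := by
      intro i hi
      have := (Finset.mem_Icc.mp hi).1
      simp only [g, if_neg (by omega : i ≠ 0), smul_eq_mul, mul_comm]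
    rw [Finset.sum_congr rfl this]
    apply Finset.sum_subset
    · intro i hi
      simp only [Finset.mem_Icc, Finset.mem_range] at *
      omega
    · intro i _ hi
      have : g i = 0 := by
        simp only [Finset.mem_Icc] at hi
        simp only [g]
        split_ifs <;> omega
      rw [this, smul_zero]
  rw [Finset.sum_congr rfl (fun c _ => hC c)]
  simp
end

section
/- Let G be a finite connected simple graph on n ≥ 2 vertices with neighbor-locating chromatic number k and average degree d, and suppose k ≥ ⌈d⌉ + 1. If n = k · Σ_{i=1}^{⌈d⌉} (⌈d⌉ + 1 − i) · C(k−1, i) (i.e., the order of G attains the upper bound), then the maximum degree of G satisfies Δ(G) ≤ ⌈d⌉ + 1, and for every i with 1 ≤ i ≤ ⌈d⌉, G has exactly k · C(k−1, i) vertices of degree exactly i. -/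
open SimpleGraph

lemma aux_bound {V : Type*} [Fintype V] (G : SimpleGraph V) [DecidableRel G.Adj]
    (k : ℕ) (f : V → Fin k) (hf : IsNLColoring G k f) (hpos : ∀ v, 1 ≤ G.degree v) (s : ℕ) :
    (Finset.univ.filter fun v => G.degree v ≤ s).card
      ≤ k * ∑ i ∈ Finset.Icc 1 s, (k - 1).choose i := by
  classical
  let N : V → Finset (Fin k) := fun v => (G.neighborFinset v).image f
  have hN : ∀ v, (N v : Set (Fin k)) = colorNbrs G f v := by
    intro v; ext c; simp [N, colorNbrs]
  let T : Finset (Σ _ : Fin k, Finset (Fin k)) :=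
    Finset.univ.sigma fun c => (Finset.Icc 1 s).biUnion fun i =>
      (Finset.univ.erase c).powersetCard i
  have hT : T.card ≤ k * ∑ i ∈ Finset.Icc 1 s, (k - 1).choose i := by
    rw [Finset.card_sigma]
    calc _ ≤ ∑ c : Fin k, ∑ i ∈ Finset.Icc 1 s, (k - 1).choose i := by
          refine Finset.sum_le_sum fun c _ => Finset.card_biUnion_le.trans (le_of_eq ?_)
          refine Finset.sum_congr rfl fun i _ => ?_
          simp [Finset.card_powersetCard, Finset.card_erase_of_mem]
      _ = _ := by simp
  refine le_trans (Finset.card_le_card_of_injOn (fun v => (⟨f v, N v⟩ : Σ _ : Fin k, Finset (Fin k))) ?_ ?_) hT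
  · intro v hv
    have hv' : G.degree v ≤ s := by simpa using hv
    have h1 : (N v).card ≤ s := Finset.card_image_le.trans (by simpa using hv')
    have h2 : 1 ≤ (N v).card := by
      rw [Nat.one_le_iff_ne_zero, Finset.card_ne_zero]
      refine Finset.Nonempty.image ?_ _
      rw [← Finset.card_pos]
      have := hpos v
      rw [G.card_neighborFinset_eq_degree]
      omega
    have h3 : N v ⊆ Finset.univ.erase (f v) := by
      intro c hc
      obtain ⟨y, hy, rfl⟩ := Finset.mem_image.1 hc
      have := hf.1 v y (by simpa using hy)
      simpa using this.symm
    simp only [T, Finset.coe_sigma, Finset.mem_coe, Finset.mem_univ, true_and,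
      Set.mem_sigma_iff, Finset.mem_biUnion, Finset.mem_powersetCard, Finset.mem_Icc]
    first
      | exact ⟨_, ⟨h2, h1⟩, h3, rfl⟩
      | exact ⟨by simp, by simpa using ⟨⟨h2, h1⟩, h3⟩⟩
  · intro u _ v _ huv
    by_contra hne
    simp only [Sigma.mk.injEq, heq_eq_eq] at huv
    exact hf.2 u v hne huv.1 (by rw [← hN, ← hN, huv.2])

lemma aux_sum (a d : ℕ) (hd : 1 ≤ d) :
    ∑ s ∈ Finset.Icc 1 a, (if d ≤ s then 1 else 0) = a + 1 - d := by
  rw [← Finset.sum_filter, Finset.sum_const, smul_eq_mul, mul_one, ← Nat.card_Icc]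
  congr 1; ext s; simp; omega

/-- Theorem 3(ii), second part: if moreover the order of `G` attains the upper bound, then
`Δ(G) ≤ ⌈d⌉ + 1` and for each `1 ≤ i ≤ ⌈d⌉` there are exactly `k · C(k-1,i)` vertices of
degree `i`. -/
theorem stmt4 {V : Type*} [Fintype V] (G : SimpleGraph V) [DecidableRel G.Adj]
    (hconn : G.Connected) (hn : 2 ≤ Fintype.card V)
    (k a : ℕ) (hk : k = nlChrom G)
    (ha : a = ⌈(∑ v, (G.degree v : ℝ)) / (Fintype.card V : ℝ)⌉₊)
    (hka : a + 1 ≤ k)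
    (heq : Fintype.card V = k * ∑ i ∈ Finset.Icc 1 a, (a + 1 - i) * (k - 1).choose i) :
    G.maxDegree ≤ a + 1 ∧
      ∀ i, 1 ≤ i → i ≤ a →
        (Finset.univ.filter fun v => G.degree v = i).card = k * (k - 1).choose i := by
  classical
  have hmem := Nat.sInf_mem (s := {k | ∃ f : V → Fin k, IsNLColoring G k f})
    (Nat.nonempty_of_pos_sInf (by change 0 < nlChrom G; omega))
  change nlChrom G ∈ _ at hmem
  rw [← hk] at hmem
  obtain ⟨f, hf⟩ := hmem
  have : Nontrivial V := Fintype.one_lt_card_iff_nontrivial.1 hn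
  have hpos : ∀ v, 1 ≤ G.degree v := fun v => hconn.preconnected.degree_pos_of_nontrivial v
  have hB := aux_bound G k f hf hpos
  have hdeg : ∑ v, G.degree v ≤ a * Fintype.card V := by
    have h := Nat.le_ceil ((∑ v, (G.degree v : ℝ)) / (Fintype.card V : ℝ))
    rw [← ha, div_le_iff₀ (by exact_mod_cast (by omega : 0 < Fintype.card V))] at h
    exact_mod_cast h
  set D : ℕ → ℕ := fun s => (Finset.univ.filter fun v => G.degree v ≤ s).card with hD
  have hDsum : ∑ s ∈ Finset.Icc 1 a, D s = ∑ v, (a + 1 - G.degree v) := by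
    simp only [hD, Finset.card_filter]
    rw [Finset.sum_comm]
    exact Finset.sum_congr rfl fun v _ => aux_sum a _ (hpos v)
  have hBsum : ∑ s ∈ Finset.Icc 1 a, (k * ∑ i ∈ Finset.Icc 1 s, (k - 1).choose i)
      = Fintype.card V := by
    rw [heq, ← Finset.mul_sum]
    congr 1
    have h1 : ∀ s ∈ Finset.Icc 1 a, ∑ i ∈ Finset.Icc 1 s, (k - 1).choose i
        = ∑ i ∈ Finset.Icc 1 a, (if i ≤ s then 1 else 0) * (k - 1).choose i := by
      intro s hs
      simp only [ite_mul, one_mul, zero_mul]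
      rw [← Finset.sum_filter]
      refine Finset.sum_congr ?_ fun _ _ => rfl
      ext i; simp at hs ⊢; omega
    rw [Finset.sum_congr rfl h1, Finset.sum_comm]
    refine Finset.sum_congr rfl fun i hi => ?_
    rw [← Finset.sum_mul, aux_sum a i (Finset.mem_Icc.1 hi).1]
  have hle : ∑ s ∈ Finset.Icc 1 a, D s ≤ Fintype.card V :=
    hBsum ▸ Finset.sum_le_sum fun s _ => hB s
  have hmax : ∑ v, (a + 1 - G.degree v) + ∑ v, G.degree v = ∑ v, max (a + 1) (G.degree v) := by
    rw [← Finset.sum_add_distrib]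
    exact Finset.sum_congr rfl fun v _ => by omega
  have hconst : ∑ _v : V, (a + 1) = a * Fintype.card V + Fintype.card V := by
    simp; ring
  have hge : ∑ _v : V, (a + 1) ≤ ∑ v, max (a + 1) (G.degree v) :=
    Finset.sum_le_sum fun v _ => le_max_left _ _
  have hD' : ∑ s ∈ Finset.Icc 1 a, D s
      = ∑ s ∈ Finset.Icc 1 a, (k * ∑ i ∈ Finset.Icc 1 s, (k - 1).choose i) := by omega
  have hDeq := (Finset.sum_eq_sum_iff_of_le fun s _ => hB s).1 hD'
  have hmeq := (Finset.sum_eq_sum_iff_of_le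
    fun v (_ : v ∈ Finset.univ) => le_max_left (a + 1) (G.degree v)).1 (by omega)
  refine ⟨G.maxDegree_le_of_forall_degree_le _ fun v => ?_, fun i hi hia => ?_⟩
  · have := hmeq v (Finset.mem_univ v)
    omega
  · have hall : ∀ s ≤ a, D s = k * ∑ i ∈ Finset.Icc 1 s, (k - 1).choose i := by
      intro s hs
      rcases Nat.eq_zero_or_pos s with rfl | h
      · have := hB 0
        simp only [hD]
        simp at this ⊢
        intro v
        have := hpos v
        omega
      · exact hDeq s (Finset.mem_Icc.2 ⟨h, hs⟩)
    obtain ⟨j, rfl⟩ : ∃ j, i = j + 1 := ⟨i - 1, by omega⟩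
    have e1 := hall (j + 1) hia
    have e0 := hall j (by omega)
    rw [Finset.sum_Icc_succ_top (by omega), mul_add, ← e0] at e1
    have hsplit : D (j + 1) = D j + (Finset.univ.filter fun v => G.degree v = j + 1).card := by
      simp only [hD, Finset.card_filter]
      rw [← Finset.sum_add_distrib]
      refine Finset.sum_congr rfl fun v _ => ?_
      split_ifs <;> omega
    omega
end

section
/- Let G be a finite connected planar simple graph on n ≥ 2 vertices with neighbor-locating chromatic number k, and suppose k ≥ 7. Then n ≤ k · Σ_{i=1}^{6} (7 − i) · C(k−1, i). -/
open SimpleGraph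

/-- `H` is a minor of `G`: there are pairwise disjoint connected branch sets in `G`,
one for each vertex of `H`, with an edge of `G` between branch sets of adjacent
vertices of `H`. -/
def HasMinor {V W : Type*} (G : SimpleGraph V) (H : SimpleGraph W) : Prop :=
  ∃ B : W → Set V,
    (∀ w, (G.induce (B w)).Connected) ∧
    (∀ w w', w ≠ w' → Disjoint (B w) (B w')) ∧
    (∀ w w', H.Adj w w' → ∃ x ∈ B w, ∃ y ∈ B w', G.Adj x y)

/-- Planarity, characterized via Wagner's theorem: a graph is planar iff it has
neither a `K₅` minor nor a `K₃,₃` minor. -/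
def IsPlanar {V : Type*} (G : SimpleGraph V) : Prop :=
  ¬ HasMinor G (⊤ : SimpleGraph (Fin 5)) ∧
  ¬ HasMinor G (completeBipartiteGraph (Fin 3) (Fin 3))

theorem minor_reach {V W : Type*} {G : SimpleGraph V} {H : SimpleGraph W} (A : W → Set V)
    (hA : ∀ w, (G.induce (A w)).Connected)
    (hadj : ∀ w w', H.Adj w w' → ∃ x ∈ A w, ∃ y ∈ A w', G.Adj x y)
    (S : Set W) (U : Set V) (hU : ∀ w ∈ S, A w ⊆ U) (a b : S) (r : (H.induce S).Reachable a b) :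
    ∀ x (hx : x ∈ A a) y (hy : y ∈ A b),
      (G.induce U).Reachable ⟨x, hU _ a.2 hx⟩ ⟨y, hU _ b.2 hy⟩ := by
  have key : ∀ (w : W) (hw : w ∈ S) x (hx : x ∈ A w) y (hy : y ∈ A w),
      (G.induce U).Reachable ⟨x, hU _ hw hx⟩ ⟨y, hU _ hw hy⟩ := by
    intro w hw x hx y hy
    have := (hA w).preconnected ⟨x, hx⟩ ⟨y, hy⟩
    exact this.map (G.induceHomOfLE (hU w hw)).toHom
  rw [reachable_iff_reflTransGen] at r
  induction r with
  | refl => intro x hx y hy; exact key _ a.2 x hx y hy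
  | @tail b c _ hbc ih =>
    intro x hx y hy
    obtain ⟨p, hp, q, hq, hpq⟩ := hadj _ _ hbc
    refine (ih x hx p hp).trans (Reachable.trans (Adj.reachable ?_) (key _ c.2 q hq y hy))
    exact hpq

theorem HasMinor.trans' {V W X : Type*} {G : SimpleGraph V} {H : SimpleGraph W}
    {K : SimpleGraph X} (h1 : HasMinor G H) (h2 : HasMinor H K) : HasMinor G K := by
  obtain ⟨A, hA, dA, eA⟩ := h1
  obtain ⟨B, hB, dB, eB⟩ := h2
  refine ⟨fun k => ⋃ w ∈ B k, A w, ?_, ?_, ?_⟩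
  · intro k
    obtain ⟨⟨w0, hw0⟩⟩ := (hB k).nonempty
    obtain ⟨⟨v0, hv0⟩⟩ := (hA w0).nonempty
    have hU : ∀ w ∈ B k, A w ⊆ ⋃ w ∈ B k, A w := fun w hw => Set.subset_biUnion_of_mem hw
    rw [connected_iff_exists_forall_reachable]
    refine ⟨⟨v0, hU _ hw0 hv0⟩, ?_⟩
    rintro ⟨v, hv⟩
    obtain ⟨w, hw, hvw⟩ := Set.mem_iUnion₂.1 hv
    exact minor_reach A hA eA (B k) _ hU ⟨w0, hw0⟩ ⟨w, hw⟩ ((hB k).preconnected _ _) v0 hv0 v hvw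
  · intro k k' hk
    rw [Set.disjoint_left]
    intro v hv hv'
    obtain ⟨w, hw, hvw⟩ := Set.mem_iUnion₂.1 hv
    obtain ⟨w', hw', hvw'⟩ := Set.mem_iUnion₂.1 hv'
    by_cases h : w = w'
    · subst h
      exact Set.disjoint_left.1 (dB k k' hk) hw hw'
    · exact Set.disjoint_left.1 (dA w w' h) hvw hvw'
  · intro k k' hk
    obtain ⟨w, hw, w', hw', hww⟩ := eB k k' hk
    obtain ⟨x, hx, y, hy, hxy⟩ := eA w w' hww
    exact ⟨x, Set.mem_iUnion₂.2 ⟨w, hw, hx⟩, y, Set.mem_iUnion₂.2 ⟨w', hw', hy⟩, hxy⟩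

theorem conn_singleton {V : Type*} (G : SimpleGraph V) (v : V) : (G.induce {v}).Connected := by
  rw [induce_singleton_eq_top]; exact connected_top

theorem hasMinor_of_inj {V W : Type*} {G : SimpleGraph V} {H : SimpleGraph W} (f : W → V)
    (hf : Function.Injective f) (h : ∀ a b, H.Adj a b → G.Adj (f a) (f b)) : HasMinor G H := by
  refine ⟨fun w => {f w}, fun w => conn_singleton G _, ?_, ?_⟩
  · intro w w' hw
    simpa using fun h => hw (hf h.symm).symm
  · intro w w' hw
    exact ⟨_, rfl, _, rfl, h _ _ hw⟩

/-- contraction of `x` into `y` -/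
def contr {V : Type*} (G : SimpleGraph V) (x y : V) : SimpleGraph ({x}ᶜ : Set V) where
  Adj a b := G.Adj a b ∨ (a.1 = y ∧ b.1 ≠ y ∧ G.Adj x b) ∨ (b.1 = y ∧ a.1 ≠ y ∧ G.Adj x a)
  symm := ⟨by
    intro a b h
    rcases h with h | h | h
    · exact Or.inl h.symm
    · exact Or.inr (Or.inr h)
    · exact Or.inr (Or.inl h)⟩
  loopless := ⟨by
    intro a h
    rcases h with h | h | h
    · exact G.irrefl h
    · exact h.2.1 h.1
    · exact h.2.1 h.1⟩

open Classical in
theorem hasMinor_contr {V : Type*} (G : SimpleGraph V) {x y : V} (hxy : G.Adj x y) :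
    HasMinor G (contr G x y) := by
  refine ⟨fun w => if w.1 = y then {x, y} else {w.1}, ?_, ?_, ?_⟩
  · intro w
    by_cases h : w.1 = y
    · beta_reduce
      rw [if_pos h]
      exact induce_pair_connected_of_adj hxy
    · beta_reduce
      rw [if_neg h]
      exact conn_singleton G _
  · rintro ⟨w, hw⟩ ⟨w', hw'⟩ hne
    simp only [Set.mem_compl_iff, Set.mem_singleton_iff, ne_eq, Subtype.mk.injEq] at hw hw' hne
    rw [Set.disjoint_left]
    intro v hv hv'
    dsimp only at hv hv'
    split_ifs at hv hv' <;> simp at hv hv' <;> grind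
  · rintro ⟨w, hw⟩ ⟨w', hw'⟩ hadj
    have self : ∀ w : V, w ∈ (if w = y then {x, y} else {w} : Set V) := by
      intro w; split_ifs with h <;> simp [h]
    rcases hadj with h | ⟨h1, h2, h3⟩ | ⟨h1, h2, h3⟩
    · exact ⟨w, self w, w', self w', h⟩
    · exact ⟨x, by simp at h1; simp [h1], w', self w', h3⟩
    · exact ⟨w, self w, x, by simp at h1; simp [h1], h3.symm⟩

open Classical in
theorem card_contr {V : Type*} [Fintype V] (G : SimpleGraph V) {x y : V} (hxy : G.Adj x y) :
    G.edgeFinset.card ≤ (contr G x y).edgeFinset.card + 1 +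
      (G.neighborFinset x ∩ G.neighborFinset y).card := by
  have hyx : y ≠ x := hxy.ne'
  have h1 : (G.induce {x}ᶜ).edgeFinset.card = G.edgeFinset.card - G.degree x := by
    rw [card_edgeFinset_induce_compl_singleton, card_edgeFinset_deleteIncidenceSet]
  let T : Finset ({x}ᶜ : Set V) := Finset.univ.filter (fun b => G.Adj x b ∧ ¬ G.Adj y b ∧ b.1 ≠ y)
  let Y : ({x}ᶜ : Set V) := ⟨y, hyx⟩
  have hT : T.card + 1 + (G.neighborFinset x ∩ G.neighborFinset y).card = G.degree x := by
    have e : T.map (Function.Embedding.subtype _) =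
        ((G.neighborFinset x) \ (G.neighborFinset y)).erase y := by
      ext b
      simp only [T, Finset.mem_map, Finset.mem_filter, Finset.mem_univ, true_and,
        Function.Embedding.subtype_apply, Finset.mem_erase, Finset.mem_sdiff, mem_neighborFinset]
      constructor
      · rintro ⟨a, ⟨h1, h2, h3⟩, rfl⟩; exact ⟨h3, h1, h2⟩
      · rintro ⟨h1, h2, h3⟩; exact ⟨⟨b, h2.ne'⟩, ⟨h2, h3, h1⟩, rfl⟩
    have e2 : T.card = (((G.neighborFinset x) \ (G.neighborFinset y)).erase y).card := by
      rw [← e, Finset.card_map]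
    have e3 : y ∈ (G.neighborFinset x) \ (G.neighborFinset y) := by simp [hxy]
    rw [e2, Finset.card_erase_add_one e3, ← card_neighborFinset_eq_degree,
      Finset.card_sdiff_add_card_inter]
  have hsub : (G.induce {x}ᶜ).edgeFinset ∪ T.image (fun b => s(Y, b)) ⊆
      (contr G x y).edgeFinset := by
    intro e he
    rw [Finset.mem_union] at he
    rcases he with he | he
    · induction e with | _ a b
      rw [mem_edgeFinset, mem_edgeSet] at he ⊢
      exact Or.inl he
    · obtain ⟨b, hb, rfl⟩ := Finset.mem_image.1 he
      rw [mem_edgeFinset, mem_edgeSet]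
      simp only [T, Finset.mem_filter, Finset.mem_univ, true_and] at hb
      exact Or.inr (Or.inl ⟨rfl, hb.2.2, hb.1⟩)
  have hdis : Disjoint (G.induce {x}ᶜ).edgeFinset (T.image (fun b => s(Y, b))) := by
    rw [Finset.disjoint_right]
    intro e he he'
    obtain ⟨b, hb, rfl⟩ := Finset.mem_image.1 he
    rw [mem_edgeFinset, mem_edgeSet] at he'
    simp only [T, Finset.mem_filter, Finset.mem_univ, true_and] at hb
    exact hb.2.1 he'
  have hc := Finset.card_le_card hsub
  rw [Finset.card_union_of_disjoint hdis, Finset.card_image_of_injective, h1] at hc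
  · omega
  · intro a b h
    rcases Sym2.eq_iff.1 h with h | h
    · exact h.2
    · rw [h.2, ← h.1]

theorem k5_of {V : Type*} {G : SimpleGraph V} {x a c b d e : V}
    (hac : a = c ∨ G.Adj a c) (hbd : G.Adj b d) (hbe : G.Adj b e) (hde : G.Adj d e)
    (hb : G.Adj a b ∨ G.Adj c b) (hd : G.Adj a d ∨ G.Adj c d) (he : G.Adj a e ∨ G.Adj c e)
    (hxa : G.Adj x a) (hxc : G.Adj x c) (hxb : G.Adj x b) (hxd : G.Adj x d) (hxe : G.Adj x e)
    (hba : b ≠ a ∧ b ≠ c) (hda : d ≠ a ∧ d ≠ c) (hea : e ≠ a ∧ e ≠ c) :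
    HasMinor G (⊤ : SimpleGraph (Fin 5)) := by
  have n1 := hbd.ne
  have n2 := hbe.ne
  have n3 := hde.ne
  have n4 := hxa.ne
  have n5 := hxc.ne
  have n6 := hxb.ne
  have n7 := hxd.ne
  have n8 := hxe.ne
  have sym : ∀ {u v}, G.Adj u v → G.Adj v u := fun h => h.symm
  refine ⟨![{x}, {a, c}, {b}, {d}, {e}], ?_, ?_, ?_⟩
  · intro w
    fin_cases w
    · exact conn_singleton G _
    · show (G.induce {a, c}).Connected
      rcases hac with rfl | h
      · rw [Set.pair_eq_singleton]; exact conn_singleton G _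
      · exact induce_pair_connected_of_adj h
    · exact conn_singleton G _
    · exact conn_singleton G _
    · exact conn_singleton G _
  · intro w w' hw
    fin_cases w <;> fin_cases w' <;> simp at hw ⊢ <;> grind
  · intro w w' hw
    fin_cases w <;> fin_cases w' <;> simp at hw ⊢ <;> grind

open Classical in
theorem k5_nbhd {V : Type*} [Fintype V] (G : SimpleGraph V) (x : V) (h0 : 0 < G.degree x)
    (h5 : G.degree x ≤ 5)
    (h : ∀ y, G.Adj x y → 3 ≤ (G.neighborFinset x ∩ G.neighborFinset y).card) :
    HasMinor G (⊤ : SimpleGraph (Fin 5)) := by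
  rw [← card_neighborFinset_eq_degree] at h0 h5
  set N := G.neighborFinset x with hN
  have hmem : ∀ y, y ∈ N ↔ G.Adj x y := by simp [hN]
  have hsub : ∀ y ∈ N, N ∩ G.neighborFinset y ⊆ N.erase y := by
    intro y hy z hz
    simp only [Finset.mem_inter, mem_neighborFinset] at hz
    exact Finset.mem_erase.2 ⟨hz.2.ne', hz.1⟩
  -- non-neighbours
  have hnon : ∀ y ∈ N, (N.filter (fun z => ¬ G.Adj y z)).card + 3 ≤ N.card := by
    intro y hy
    have e : N ∩ G.neighborFinset y = N.filter (fun z => G.Adj y z) := by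
      ext z; simp
    have := h y ((hmem y).1 hy)
    rw [e] at this
    have := Finset.card_filter_add_card_filter_not (s := N) (fun z => G.Adj y z)
    omega
  obtain ⟨y, hy⟩ := Finset.card_pos.1 h0
  have h4 : 4 ≤ N.card := by
    have h1 := h y ((hmem y).1 hy)
    have := Finset.card_le_card (hsub y hy)
    rw [Finset.card_erase_of_mem hy] at this
    omega
  -- each vertex has at most `card - 3` nonneighbours including itself
  have h4' : N.card = 4 ∨ N.card = 5 := by omega
  rcases h4' with hc | hc
  · have hall : ∀ y ∈ N, ∀ z ∈ N, y ≠ z → G.Adj y z := by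
      intro y hy z hz hyz
      by_contra hcon
      have h2 : ({y, z} : Finset V) ⊆ N.filter (fun z => ¬ G.Adj y z) := by
        intro t ht
        simp only [Finset.mem_insert, Finset.mem_singleton] at ht
        rcases ht with rfl | rfl <;> simp [hy, hz, hcon]
      have := Finset.card_le_card h2
      rw [Finset.card_pair hyz] at this
      have := hnon y hy
      omega
    obtain ⟨a, b, d, e, hab, had, hae, hbd, hbe, hde, hNe⟩ := Finset.card_eq_four.1 hc
    have ha : a ∈ N := by simp [hNe]
    have hb : b ∈ N := by simp [hNe]
    have hd : d ∈ N := by simp [hNe]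
    have he : e ∈ N := by simp [hNe]
    simp only [hmem] at *
    refine k5_of (x := x) (a := a) (c := a) (b := b) (d := d) (e := e) ?_ ?_ ?_ ?_ ?_ ?_ ?_ ?_ ?_ ?_ ?_ ?_ ?_ ?_ ?_ <;> grind
  · have hall : ∀ y ∈ N, ∀ z ∈ N, ∀ w ∈ N, y ≠ z → y ≠ w → z ≠ w → G.Adj y z ∨ G.Adj y w := by
      intro y hy z hz w hw hyz hyw hzw
      by_contra hcon
      push Not at hcon
      have h2 : ({y, z, w} : Finset V) ⊆ N.filter (fun z => ¬ G.Adj y z) := by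
        intro t ht
        simp only [Finset.mem_insert, Finset.mem_singleton] at ht
        rcases ht with rfl | rfl | rfl <;> simp [hy, hz, hw, hcon]
      have := Finset.card_le_card h2
      rw [Finset.card_eq_three.2 ⟨y, z, w, hyz, hyw, hzw, rfl⟩] at this
      have := hnon y hy
      omega
    -- enumerations
    have sym : ∀ {u v}, G.Adj u v → G.Adj v u := fun h => h.symm
    have pick3 : ∀ a ∈ N, ∀ b ∈ N, a ≠ b → ∃ c d e, c ∈ N ∧ d ∈ N ∧ e ∈ N ∧ c ≠ d ∧ c ≠ e ∧ d ≠ e ∧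
        a ≠ c ∧ a ≠ d ∧ a ≠ e ∧ b ≠ c ∧ b ≠ d ∧ b ≠ e := by
      intro a ha b hb hab
      have : ((N.erase a).erase b).card = 3 := by
        rw [Finset.card_erase_of_mem (Finset.mem_erase.2 ⟨hab.symm, hb⟩),
          Finset.card_erase_of_mem ha, hc]
      obtain ⟨c, d, e, hcd, hce, hde, hE⟩ := Finset.card_eq_three.1 this
      have hc' : c ∈ (N.erase a).erase b := by simp [hE]
      have hd' : d ∈ (N.erase a).erase b := by simp [hE]
      have he' : e ∈ (N.erase a).erase b := by simp [hE]
      simp only [Finset.mem_erase] at hc' hd' he'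
      exact ⟨c, d, e, hc'.2.2, hd'.2.2, he'.2.2, hcd, hce, hde, hc'.2.1.symm, hd'.2.1.symm,
        he'.2.1.symm, hc'.1.symm, hd'.1.symm, he'.1.symm⟩
    have two : ∀ a ∈ N, ∀ b ∈ N, ∀ c ∈ N, ∀ d ∈ N, ∀ e ∈ N, a ≠ b → a ≠ c → a ≠ d → a ≠ e →
        b ≠ c → b ≠ d → b ≠ e → c ≠ d → c ≠ e → d ≠ e → ¬ G.Adj a b → ¬ G.Adj c d →
        HasMinor G (⊤ : SimpleGraph (Fin 5)) := by
      intro a ha b hb c hc d hd e he hab hac had hae hbc hbd hbe hcd hce hde nab ncd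
      have q1 := (hall a ha b hb c hc hab hac hbc).resolve_left nab
      have q2 := (hall a ha b hb d hd hab had hbd).resolve_left nab
      have q3 := (hall a ha b hb e he hab hae hbe).resolve_left nab
      have nba : ¬ G.Adj b a := fun h => nab h.symm
      have ndc : ¬ G.Adj d c := fun h => ncd h.symm
      have q4 := (hall b hb a ha c hc hab.symm hbc hac).resolve_left nba
      have q5 := (hall b hb a ha d hd hab.symm hbd had).resolve_left nba
      have q6 := (hall b hb a ha e he hab.symm hbe hae).resolve_left nba
      have q7 := (hall d hd c hc e he hcd.symm hde hce).resolve_left ndc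
      exact k5_of (x := x) (a := a) (c := c) (b := b) (d := d) (e := e) (Or.inr q1) q5 q6 q7
        (Or.inr q4.symm) (Or.inl q2) (Or.inl q3) ((hmem _).1 ha) ((hmem _).1 hc) ((hmem _).1 hb)
        ((hmem _).1 hd) ((hmem _).1 he) ⟨hab.symm, hbc⟩ ⟨had.symm, hcd.symm⟩ ⟨hae.symm, hce.symm⟩
    have fin : ∀ b ∈ N, ∀ c ∈ N, ∀ d ∈ N, ∀ e ∈ N, G.Adj b c → G.Adj b d → G.Adj b e → G.Adj c d →
        G.Adj c e → G.Adj d e → HasMinor G (⊤ : SimpleGraph (Fin 5)) := by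
      intro b hb c hc d hd e he h1 h2 h3 h4 h5 h6
      exact k5_of (x := x) (a := b) (c := b) (b := c) (d := d) (e := e) (Or.inl rfl) h4 h5 h6
        (Or.inl h1) (Or.inl h2) (Or.inl h3) ((hmem _).1 hb) ((hmem _).1 hb) ((hmem _).1 hc)
        ((hmem _).1 hd) ((hmem _).1 he) ⟨h1.ne', h1.ne'⟩ ⟨h2.ne', h2.ne'⟩ ⟨h3.ne', h3.ne'⟩
    by_cases hex : ∃ a ∈ N, ∃ b ∈ N, a ≠ b ∧ ¬ G.Adj a b
    · obtain ⟨a, ha, b, hb, hab, nab⟩ := hex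
      obtain ⟨c, d, e, hc, hd, he, hcd, hce, hde, hac, had, hae, hbc, hbd, hbe⟩ := pick3 a ha b hb hab
      have nba : ¬ G.Adj b a := fun h => nab h.symm
      have q4 := (hall b hb a ha c hc hab.symm hbc hac).resolve_left nba
      have q5 := (hall b hb a ha d hd hab.symm hbd had).resolve_left nba
      have q6 := (hall b hb a ha e he hab.symm hbe hae).resolve_left nba
      by_cases p1 : G.Adj c d
      · by_cases p2 : G.Adj c e
        · by_cases p3 : G.Adj d e
          · exact fin b hb c hc d hd e he q4 q5 q6 p1 p2 p3
          · exact two a ha b hb d hd e he c hc hab had hae hac hbd hbe hbc hde hcd.symm hce.symm nab p3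
        · exact two a ha b hb c hc e he d hd hab hac hae had hbc hbe hbd hce hcd hde.symm nab p2
      · exact two a ha b hb c hc d hd e he hab hac had hae hbc hbd hbe hcd hce hde nab p1
    · push Not at hex
      obtain ⟨z, hz, hzy⟩ := Finset.exists_mem_ne (by omega : 1 < N.card) y
      obtain ⟨c, d, e, hc, hd, he, hcd, hce, hde, hac, had, hae, hbc, hbd, hbe⟩ := pick3 y hy z hz hzy.symm
      exact fin y hy c hc d hd e he (hex _ hy _ hc hac) (hex _ hy _ hd had) (hex _ hy _ he hae)
        (hex _ hc _ hd hcd) (hex _ hc _ he hce) (hex _ hd _ he hde)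

open Classical in
theorem exists_sub {V : Type*} [Fintype V] (G0 : SimpleGraph V) (m : ℕ)
    (hm : m ≤ G0.edgeFinset.card) : ∃ G : SimpleGraph V, G ≤ G0 ∧ G.edgeFinset.card = m := by
  obtain ⟨S, hS, hSc⟩ := Finset.exists_subset_card_eq hm
  refine ⟨fromEdgeSet (S : Set (Sym2 V)), ?_, ?_⟩
  · intro a b hab
    have : s(a, b) ∈ S := by simpa using ((fromEdgeSet_adj _).1 hab).1
    simpa using hS this
  · rw [← hSc]
    congr 1
    ext e
    refine (@mem_edgeFinset V _ e (_)).trans ?_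
    rw [edgeSet_fromEdgeSet]
    constructor
    · intro h; simpa using h.1
    · intro h
      exact ⟨by simpa using h, fun hd => G0.not_isDiag_of_mem_edgeSet (mem_edgeFinset.1 (hS h)) hd⟩

open Classical in
theorem mader5.{u} (n : ℕ) : ∀ {V : Type u} [Fintype V] (G : SimpleGraph V),
    Fintype.card V = n + 3 → ¬ HasMinor G (⊤ : SimpleGraph (Fin 5)) →
    G.edgeFinset.card + 6 ≤ 3 * (n + 3) := by
  induction n with
  | zero =>
    intro V _ G hV _
    have := G.card_edgeFinset_le_card_choose_two
    rw [hV] at this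
    have e : (0 + 3).choose 2 = 3 := by decide
    omega
  | succ n ih =>
    intro V _ G0 hV hG0
    by_contra hcon
    obtain ⟨G, hle, hcard⟩ := exists_sub G0 (3 * n + 7) (by omega)
    have hG : ¬ HasMinor G (⊤ : SimpleGraph (Fin 5)) := fun h =>
      hG0 ((hasMinor_of_inj id Function.injective_id hle).trans' h)
    have hsum := G.sum_degrees_eq_twice_card_edges
    obtain ⟨x, hx⟩ : ∃ x, G.degree x ≤ 5 := by
      by_contra hall
      push Not at hall
      have : ∑ v : V, 6 ≤ ∑ v, G.degree v := Finset.sum_le_sum fun v _ => hall v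
      simp [hV] at this
      omega
    have hV' : Fintype.card ({x}ᶜ : Set V) = n + 3 := by
      rw [Fintype.card_compl_set]; simp [hV]
    by_cases h0 : G.degree x = 0
    · have h1 : (G.induce {x}ᶜ).edgeFinset.card = G.edgeFinset.card - G.degree x := by
        rw [card_edgeFinset_induce_compl_singleton, card_edgeFinset_deleteIncidenceSet]
      have : (G.induce {x}ᶜ).edgeFinset.card + 6 ≤ 3 * (n + 3) := by
        convert ih (G.induce {x}ᶜ) hV' (fun h => hG
        ((hasMinor_of_inj Subtype.val Subtype.val_injective (fun _ _ h => h)).trans' h))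
      omega
    · apply hG
      refine k5_nbhd G x (Nat.pos_of_ne_zero h0) hx ?_
      intro y hxy
      have h1 := card_contr G hxy
      have h2 := ih (contr G x y) hV' (fun h => hG ((hasMinor_contr G hxy).trans' h))
      omega

open Classical in
theorem edges_le {V : Type*} [Fintype V] (G : SimpleGraph V)
    (hG : ¬ HasMinor G (⊤ : SimpleGraph (Fin 5))) : G.edgeFinset.card ≤ 3 * Fintype.card V := by
  by_cases h : 3 ≤ Fintype.card V
  · have := mader5 (Fintype.card V - 3) G (by omega) hG
    omega
  · have := G.card_edgeFinset_le_card_choose_two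
    have h2 : Fintype.card V < 3 := by omega
    have h3 : ∀ m < 3, m.choose 2 ≤ 3 * m := by decide
    exact this.trans (h3 _ h2)

theorem stmt5 {V : Type*} [Fintype V] (G : SimpleGraph V)
    (hconn : G.Connected) (hplanar : IsPlanar G) (hn : 2 ≤ Fintype.card V)
    (k : ℕ) (hk : k = nlChrom G) (hk7 : 7 ≤ k) :
    Fintype.card V ≤ k * ∑ i ∈ Finset.Icc 1 6, (7 - i) * (k - 1).choose i := by
  classical
  have hne : {k | ∃ f : V → Fin k, IsNLColoring G k f}.Nonempty := by
    apply Nat.nonempty_of_pos_sInf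
    unfold nlChrom at hk
    omega
  obtain ⟨f, hf1, hf2⟩ : ∃ f : V → Fin k, IsNLColoring G k f := by
    rw [hk]; exact Nat.sInf_mem hne
  let D : V → Finset (Fin k) := fun x => (G.neighborFinset x).image f
  have hD : ∀ x, (D x : Set (Fin k)) = colorNbrs G f x := by
    intro x; ext c; simp [D, colorNbrs]
  have hDdeg : ∀ x, (D x).card ≤ G.degree x := fun x => Finset.card_image_le
  have hDpos : ∀ x, (D x).card ≠ 0 := by
    intro x h
    have : Nontrivial V := Fintype.one_lt_card_iff_nontrivial.1 hn
    have := hconn.preconnected.degree_pos_of_nontrivial x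
    rw [← card_neighborFinset_eq_degree, Finset.card_pos] at this
    have := this.image f
    rw [← Finset.card_pos] at this
    exact this.ne' h
  have hfD : ∀ x, f x ∉ D x := by
    intro x h
    obtain ⟨y, hy, hxy⟩ := Finset.mem_image.1 h
    exact hf1 x y (by simpa using hy) hxy.symm
  let g : ℕ → ℕ := fun i => if i = 0 then 0 else 7 - i
  have h1 : Fintype.card V ≤ ∑ x, g (D x).card := by
    have hs := G.sum_degrees_eq_twice_card_edges
    have he := edges_le G hplanar.1
    have h7 : ∑ x : V, 7 ≤ ∑ x, (g (D x).card + G.degree x) := by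
      refine Finset.sum_le_sum fun x _ => ?_
      have := hDdeg x
      simp only [g, if_neg (hDpos x)]
      omega
    rw [Finset.sum_add_distrib] at h7
    simp at h7
    omega
  let φ : V → (Σ _ : Fin k, Finset (Fin k)) := fun x => ⟨f x, D x⟩
  have hφ : Function.Injective φ := by
    intro x y hxy
    simp only [φ, Sigma.mk.injEq, heq_eq_eq] at hxy
    by_contra hne
    exact hf2 x y hne hxy.1 (by rw [← hD, ← hD, hxy.2])
  let P : Finset (Σ _ : Fin k, Finset (Fin k)) :=
    Finset.univ.sigma fun c => (Finset.univ.erase c).powerset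
  have h2 : ∑ x, g (D x).card ≤ ∑ p ∈ P, g p.2.card := by
    calc ∑ x, g (D x).card = ∑ p ∈ Finset.univ.image φ, g p.2.card := by
          rw [Finset.sum_image (fun a _ b _ h => hφ h)]
      _ ≤ _ := by
          apply Finset.sum_le_sum_of_subset
          intro p hp
          obtain ⟨x, _, rfl⟩ := Finset.mem_image.1 hp
          simp only [P, φ, Finset.mem_sigma, Finset.mem_univ, true_and, Finset.mem_powerset]
          intro c hc
          refine Finset.mem_erase.2 ⟨?_, Finset.mem_univ _⟩
          rintro rfl
          exact hfD x hc
  have h3 : ∑ p ∈ P, g p.2.card = k * ∑ i ∈ Finset.Icc 1 6, (7 - i) * (k - 1).choose i := by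
    simp only [P]
    rw [Finset.sum_sigma]
    have : ∀ c : Fin k, ∑ s ∈ (Finset.univ.erase c).powerset, g s.card =
        ∑ i ∈ Finset.Icc 1 6, (7 - i) * (k - 1).choose i := by
      intro c
      rw [Finset.sum_powerset_apply_card (fun i => g i)]
      rw [Finset.card_erase_of_mem (Finset.mem_univ c), Finset.card_univ, Fintype.card_fin]
      symm
      have : ∑ i ∈ Finset.Icc 1 6, (7 - i) * (k - 1).choose i =
          ∑ i ∈ Finset.Icc 1 6, (k - 1).choose i • g i := by
        refine Finset.sum_congr rfl fun i hi => ?_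
        have := Finset.mem_Icc.1 hi
        simp only [g, if_neg (by omega : i ≠ 0), smul_eq_mul, mul_comm]
      rw [this]
      apply Finset.sum_subset
      · intro i hi
        have := Finset.mem_Icc.1 hi
        exact Finset.mem_range.2 (by omega)
      · intro i _ hi
        have : g i = 0 := by
          simp only [g, Finset.mem_Icc] at hi ⊢
          split_ifs <;> omega
        simp [this]
    simp only [this]
    simp
  omega
end

section
/- Let G be a finite simple graph admitting a neighbor-locating k-coloring. Then for every integer s with 1 ≤ s ≤ k − 1, the number of vertices v of G with 1 ≤ deg(v) ≤ s is at most k · Σ_{i=1}^{s} C(k−1, i). -/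
open SimpleGraph

/-- If `G` admits a neighbor-locating `k`-coloring, then for every `1 ≤ s ≤ k - 1` the
number of vertices of degree between `1` and `s` is at most `k · Σ_{i=1}^{s} C(k-1, i)`. -/
theorem stmt6 {V : Type*} [Fintype V] (G : SimpleGraph V) [DecidableRel G.Adj]
    (k : ℕ) (f : V → Fin k) (hf : IsNLColoring G k f)
    (s : ℕ) (hs1 : 1 ≤ s) (hsk : s ≤ k - 1) :
    (Finset.univ.filter fun v => 1 ≤ G.degree v ∧ G.degree v ≤ s).card ≤
      k * ∑ i ∈ Finset.Icc 1 s, (k - 1).choose i := by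
  classical
  let T : Finset ((_ : Fin k) × Finset (Fin k)) :=
    Finset.univ.sigma fun c => (Finset.Icc 1 s).biUnion fun i =>
      (Finset.univ.erase c).powersetCard i
  have hT : T.card ≤ k * ∑ i ∈ Finset.Icc 1 s, (k - 1).choose i := by
    simp only [T, Finset.card_sigma]
    refine (Finset.sum_le_card_nsmul _ _ (∑ i ∈ Finset.Icc 1 s, (k - 1).choose i) ?_).trans ?_
    · intro c _
      refine Finset.card_biUnion_le.trans (Finset.sum_le_sum fun i _ => ?_)
      simp [Finset.card_powersetCard, Finset.card_erase_of_mem]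
    · simp
  refine le_trans ?_ hT
  refine Finset.card_le_card_of_injOn
    (fun v => ⟨f v, (G.neighborFinset v).image f⟩) ?_ ?_
  · intro v hv
    have hv' : 1 ≤ G.degree v ∧ G.degree v ≤ s := by simpa using hv
    have h1 : ((G.neighborFinset v).image f).card ≤ G.degree v := Finset.card_image_le
    have h2 : 1 ≤ ((G.neighborFinset v).image f).card := by
      rw [Nat.one_le_iff_ne_zero, ← Nat.pos_iff_ne_zero, Finset.card_pos,
        Finset.image_nonempty, ← Finset.card_pos]
      exact hv'.1
    simp only [T, Finset.mem_coe, Finset.mem_sigma, Finset.mem_univ, true_and,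
      Finset.mem_biUnion, Finset.mem_powersetCard, Finset.mem_Icc]
    refine ⟨_, ⟨h2, h1.trans hv'.2⟩, ?_, rfl⟩
    intro c hc
    obtain ⟨y, hy, rfl⟩ := Finset.mem_image.1 hc
    rw [SimpleGraph.mem_neighborFinset] at hy
    simpa using (hf.1 v y hy).symm
  · intro u _ v _ h
    by_contra hne
    simp only [Sigma.mk.injEq, heq_eq_eq] at h
    refine hf.2 u v hne h.1 ?_
    have h2 := h.2
    ext c
    have := Finset.ext_iff.1 h2 c
    simpa [colorNbrs] using this
end

section
/- For all integers Δ ≥ 2 and s ≥ 4, there exists a finite connected simple graph G with maximum degree Δ such that χ_NL(G) ≤ (Δ − 1)·s and G has at least (5/32)·Δ·s^(Δ+1) vertices. In particular, with k = χ_NL(G), the number of vertices of G is at least (5/32)·Δ·(k/(Δ−1))^(Δ+1). -/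
open SimpleGraph

def tri {α : Type*} : List α → List (α × Sym2 α)
  | x :: y :: z :: l => (y, s(x, z)) :: tri (y :: z :: l)
  | _ => []

theorem tri_length {α : Type*} (L : List α) : (tri L).length = L.length - 2 := by
  fun_induction tri L with
  | case1 x y z l ih => simp only [List.length_cons, ih]; omega
  | case2 l h =>
    match l, h with
    | [], _ => rfl
    | [_], _ => rfl
    | [_, _], _ => rfl
    | x :: y :: z :: l, h => exact absurd rfl (h x y z l)

theorem tri_get {α : Type*} (L : List α) : ∀ (i : ℕ) (h : i + 2 < L.length)
    (h' : i < (tri L).length), (tri L)[i] = (L[i+1], s(L[i], L[i+2])) := by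
  fun_induction tri L with
  | case1 x y z l ih =>
    intro i h h'
    cases i with
    | zero => simp
    | succ i =>
      have := ih i (by simp at h ⊢; omega) (by simp at h'; omega)
      simpa using this
  | case2 l h =>
    intro i _ h'
    simp at h'

theorem tri_append {α : Type*} (P : List α) (x y : α) (Q : List α) :
    tri (P ++ x :: y :: Q) = tri (P ++ [x, y]) ++ tri (x :: y :: Q) := by
  induction P with
  | nil => simp [tri]
  | cons p P ih =>
    match P with
    | [] => simp [tri]
    | [q] => simp [tri]
    | q :: r :: P => simpa [tri] using ih

theorem tri_infix {α : Type*} (L : List α) (a b c : α) : (b, s(a, c)) ∈ tri L →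
    ∃ P Q, L = P ++ a :: b :: Q ∨ L = P ++ b :: a :: Q := by
  fun_induction tri L with
  | case1 x y z l ih =>
    intro h
    rcases List.mem_cons.1 h with h | h
    · simp only [Prod.mk.injEq, Sym2.eq_iff] at h
      rcases h with ⟨rfl, ⟨rfl, rfl⟩ | ⟨rfl, rfl⟩⟩
      · exact ⟨[], _, Or.inl rfl⟩
      · exact ⟨[c], l, Or.inr rfl⟩
    · obtain ⟨P, Q, h⟩ := ih h
      refine ⟨x :: P, Q, ?_⟩
      rcases h with h | h
      · left; simp [h]
      · right; simp [h]
  | case2 l h => simp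

structure Good {α : Type*} (o p q : α) (L : List α) : Prop where
  pre : [o, p] <+: L
  suf : [o, p] <:+ L
  nd : (tri L).Nodup
  hp : ∀ a b c, (b, s(a, c)) ∈ tri L → a ≠ b
  ht : ∀ a b c, a ≠ c → (b, s(a, c)) ∈ tri L → (a, s(b, c)) ∈ tri L
  hd : ∀ a b, (b, s(a, a)) ∈ tri L → (a, s(b, b)) ∈ tri L
  base : (p, s(o, q)) ∈ tri L

theorem ins_perm {α : Type*} (P : List α) (x y : α) (W Q : List α) :
    (tri (P ++ x :: y :: (W ++ x :: y :: Q))).Perm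
      (tri (P ++ x :: y :: Q) ++ tri (x :: y :: (W ++ [x, y]))) := by
  have h : tri (x :: y :: (W ++ x :: y :: Q)) = tri (x :: y :: (W ++ [x, y])) ++ tri (x :: y :: Q) := by
    simpa using tri_append (x :: y :: W) x y Q
  rw [tri_append, h, tri_append P x y Q, List.append_assoc]
  exact List.Perm.append_left _ List.perm_append_comm

theorem good_ins {α : Type*} {o p q : α} {P Q : List α} {x y : α} (W : List α)
    (g : Good o p q (P ++ x :: y :: Q))
    (nd : (tri (P ++ x :: y :: Q) ++ tri (x :: y :: (W ++ [x, y]))).Nodup)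
    (hp : ∀ a b c, (b, s(a, c)) ∈ tri (x :: y :: (W ++ [x, y])) → a ≠ b)
    (ht : ∀ a b c, a ≠ c → (b, s(a, c)) ∈ tri (x :: y :: (W ++ [x, y])) →
      (a, s(b, c)) ∈ tri (x :: y :: (W ++ [x, y])))
    (hd : ∀ a b, (b, s(a, a)) ∈ tri (x :: y :: (W ++ [x, y])) →
      (a, s(b, b)) ∈ tri (x :: y :: (W ++ [x, y]))) :
    Good o p q (P ++ x :: y :: (W ++ x :: y :: Q)) := by
  have hperm := ins_perm P x y W Q
  have hm : ∀ t, t ∈ tri (P ++ x :: y :: (W ++ x :: y :: Q)) ↔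
      t ∈ tri (P ++ x :: y :: Q) ∨ t ∈ tri (x :: y :: (W ++ [x, y])) := by
    intro t; rw [hperm.mem_iff, List.mem_append]
  refine ⟨?_, ?_, hperm.nodup_iff.2 nd, ?_, ?_, ?_, ?_⟩
  · have h1 : P ++ [x, y] <+: P ++ x :: y :: Q := ⟨Q, by simp⟩
    have h2 : P ++ [x, y] <+: P ++ x :: y :: (W ++ x :: y :: Q) := ⟨W ++ x :: y :: Q, by simp⟩
    exact (List.prefix_of_prefix_length_le g.pre h1 (by simp)).trans h2
  · have h1 : x :: y :: Q <:+ P ++ x :: y :: Q := ⟨P, by simp⟩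
    have h2 : x :: y :: Q <:+ P ++ x :: y :: (W ++ x :: y :: Q) := ⟨P ++ x :: y :: W, by simp⟩
    exact (List.suffix_of_suffix_length_le g.suf h1 (by simp)).trans h2
  · intro a b c h
    rcases (hm _).1 h with h | h
    · exact g.hp _ _ _ h
    · exact hp _ _ _ h
  · intro a b c hac h
    rcases (hm _).1 h with h | h
    · exact (hm _).2 (Or.inl (g.ht _ _ _ hac h))
    · exact (hm _).2 (Or.inr (ht _ _ _ hac h))
  · intro a b h
    rcases (hm _).1 h with h | h
    · exact (hm _).2 (Or.inl (g.hd _ _ h))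
    · exact (hm _).2 (Or.inr (hd _ _ h))
  · exact (hm _).2 (Or.inl g.base)

theorem ins_triangle {α : Type*} {o p q : α} {P Q : List α} {x y z : α}
    (g : Good o p q (P ++ x :: y :: Q)) (hxy : x ≠ y) (hxz : x ≠ z) (hyz : y ≠ z)
    (hn : (z, s(x, y)) ∉ tri (P ++ x :: y :: Q)) :
    Good o p q (P ++ x :: y :: ([z] ++ x :: y :: Q)) := by
  have e : tri (x :: y :: ([z] ++ [x, y])) = [(y, s(x, z)), (z, s(y, x)), (x, s(z, y))] := by
    simp [tri]
  have n1 : (z, s(y, x)) ∉ tri (P ++ x :: y :: Q) := by rwa [Sym2.eq_swap]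
  have n2 : (y, s(x, z)) ∉ tri (P ++ x :: y :: Q) := fun h => by
    rw [Sym2.eq_swap] at h
    exact n1 (g.ht _ _ _ hxz.symm h)
  have n3 : (x, s(z, y)) ∉ tri (P ++ x :: y :: Q) := fun h => hn (g.ht _ _ _ hyz.symm h)
  apply good_ins [z] g
  · rw [e, List.nodup_append']
    refine ⟨g.nd, ?_, ?_⟩
    · simp; grind
    · intro t h1 h2
      simp at h2
      rcases h2 with rfl | rfl | rfl
      · exact n2 h1
      · exact n1 h1
      · exact n3 h1
  · intro a b c; rw [e]; simp; grind
  · intro a b c; rw [e]; simp; grind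
  · intro a b; rw [e]; simp; grind

theorem ins_digon {α : Type*} {o p q : α} {P Q : List α} {x y : α}
    (g : Good o p q (P ++ x :: y :: Q)) (hxy : x ≠ y)
    (hn : (x, s(y, y)) ∉ tri (P ++ x :: y :: Q)) :
    Good o p q (P ++ x :: y :: ([] ++ x :: y :: Q)) := by
  have e : tri (x :: y :: ([] ++ [x, y])) = [(y, s(x, x)), (x, s(y, y))] := by
    simp [tri]
  have n2 : (y, s(x, x)) ∉ tri (P ++ x :: y :: Q) := fun h => hn (g.hd _ _ h)
  apply good_ins [] g
  · rw [e, List.nodup_append']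
    refine ⟨g.nd, ?_, ?_⟩
    · simp; grind
    · intro t h1 h2
      simp at h2
      rcases h2 with rfl | rfl
      · exact n2 h1
      · exact hn h1
  · intro a b c; rw [e]; simp; grind
  · intro a b c; rw [e]; simp; grind
  · intro a b; rw [e]; simp; grind

theorem exists_full {α : Type*} [Fintype α] {o p q : α} (h1 : o ≠ p) (h2 : o ≠ q) (h3 : p ≠ q) :
    ∃ L : List α, Good o p q L ∧ ∀ a b c, a ≠ b → c ≠ b → (b, s(a, c)) ∈ tri L := by
  classical
  have g0 : Good o p q [o, p, q, o, p] := by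
    have e : tri [o, p, q, o, p] = [(p, s(o, q)), (q, s(p, o)), (o, s(q, p))] := by simp [tri]
    refine ⟨⟨[q, o, p], rfl⟩, ⟨[o, p, q], rfl⟩, ?_, ?_, ?_, ?_, ?_⟩
    · rw [e]; simp; grind
    · intro a b c; rw [e]; simp; grind
    · intro a b c; rw [e]; simp; grind
    · intro a b; rw [e]; simp; grind
    · rw [e]; simp
  have bd : ∀ L : List α, Good o p q L → L.length ≤ Fintype.card (α × Sym2 α) + 2 := by
    intro L g
    have := g.nd.length_le_card
    rw [tri_length] at this
    omega
  obtain ⟨L, g, hmax⟩ : ∃ L, Good o p q L ∧ ∀ L', Good o p q L' → L'.length ≤ L.length := by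
    let S : Set ℕ := {n | ∃ L, Good o p q L ∧ L.length = n}
    have hS : S.Nonempty := ⟨_, _, g0, rfl⟩
    have hB : BddAbove S := ⟨Fintype.card (α × Sym2 α) + 2, by
      rintro n ⟨L, g, rfl⟩; exact bd L g⟩
    obtain ⟨L, g, e⟩ := Nat.sSup_mem hS hB
    exact ⟨L, g, fun L' g' => e ▸ le_csSup hB ⟨L', g', rfl⟩⟩
  refine ⟨L, g, ?_⟩
  -- presence of an edge gives all triangles and digons
  have T : ∀ a b c z, (b, s(a, c)) ∈ tri L → z ≠ a → z ≠ b → (z, s(a, b)) ∈ tri L := by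
    intro a b c z h hza hzb
    by_contra hn
    have hab := g.hp _ _ _ h
    obtain ⟨P, Q, rfl | rfl⟩ := tri_infix L a b c h
    · have := hmax _ (ins_triangle g hab hza.symm hzb.symm hn)
      simp at this; omega
    · rw [Sym2.eq_swap] at hn
      have := hmax _ (ins_triangle g hab.symm hzb.symm hza.symm hn)
      simp at this; omega
  have D : ∀ a b c, (b, s(a, c)) ∈ tri L → (b, s(a, a)) ∈ tri L := by
    intro a b c h
    by_contra hn
    have hab := g.hp _ _ _ h
    obtain ⟨P, Q, rfl | rfl⟩ := tri_infix L a b c h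
    · have := hmax _ (ins_digon g hab (fun h => hn (g.hd _ _ h)))
      simp at this
    · have := hmax _ (ins_digon g hab.symm hn)
      simp at this
  -- edges
  let E : α → α → Prop := fun a b => ∃ c, (b, s(a, c)) ∈ tri L
  have Es : ∀ a b, E a b → E b a := by
    rintro a b ⟨c, h⟩
    exact ⟨b, g.hd _ _ (D _ _ _ h)⟩
  have Et : ∀ a b z, E a b → z ≠ a → z ≠ b → E a z := by
    rintro a b z ⟨c, h⟩ ha hb
    exact ⟨b, T _ _ _ _ h ha hb⟩
  have Eop : E o p := ⟨q, g.base⟩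
  have Eo : ∀ z, z ≠ o → E o z := by
    intro z hz
    by_cases hzp : z = p
    · rw [hzp]; exact Eop
    · exact Et _ _ _ Eop hz hzp
  have Eall : ∀ a b, a ≠ b → E a b := by
    intro a b hab
    by_cases ha : a = o
    · rw [ha]; exact Eo b (by rw [← ha]; exact hab.symm)
    · by_cases hb : b = o
      · rw [hb]; exact Es _ _ (Eo a ha)
      · exact Et _ _ _ (Es _ _ (Eo a ha)) hab.symm hb
  intro a b c hab hcb
  by_cases hac : a = c
  · subst hac
    obtain ⟨c, h⟩ := Eall a b hab
    exact D _ _ _ h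
  · obtain ⟨d, h⟩ := Eall a c hac
    exact T _ _ _ _ h hab.symm hcb.symm

theorem exists_cyc {α : Type*} [Fintype α] {o p q : α} (h1 : o ≠ p) (h2 : o ≠ q) (h3 : p ≠ q) :
    ∃ (m : ℕ) (c : Fin (m + 3) → α),
      (∀ i j, c i = c j → s(c (i - 1), c (i + 1)) = s(c (j - 1), c (j + 1)) → i = j) ∧
      (∀ i, c i ≠ c (i + 1)) ∧
      ∀ a b d, a ≠ b → d ≠ b → ∃ i, c i = b ∧ s(c (i - 1), c (i + 1)) = s(a, d) := by
  obtain ⟨L, g, hf⟩ := exists_full h1 h2 h3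
  have hlen : 3 ≤ (tri L).length := by
    have hsub : [(p, s(o, o)), (o, s(p, p)), (q, s(o, o))] ⊆ tri L := by
      intro t ht
      simp at ht
      rcases ht with rfl | rfl | rfl
      · exact hf _ _ _ h1 h1
      · exact hf _ _ _ h1.symm h1.symm
      · exact hf _ _ _ h2 h2
    have hnd : [(p, s(o, o)), (o, s(p, p)), (q, s(o, o))].Nodup := by simp; grind
    simpa using (hnd.subperm hsub).length_le
  obtain ⟨m, hm⟩ : ∃ m, (tri L).length = m + 3 := ⟨(tri L).length - 3, by omega⟩
  have hL : L.length = m + 3 + 2 := by rw [tri_length] at hm; omega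
  have w0 : ∀ h : m + 3 < L.length, L[m + 3] = L[0] := by
    intro h
    obtain ⟨A, hA⟩ := g.pre
    obtain ⟨B, hB⟩ := g.suf
    have lB : B.length = m + 3 := by rw [← hB] at hL; simpa using hL
    have e1 : L[0] = o := by simp [← hA]
    have e2 : L[m + 3] = o := by simp [← hB, ← lB]
    rw [e1, e2]
  have w1 : ∀ h : m + 4 < L.length, L[m + 4] = L[1] := by
    intro h
    obtain ⟨A, hA⟩ := g.pre
    obtain ⟨B, hB⟩ := g.suf
    have lB : B.length = m + 3 := by rw [← hB] at hL; simpa using hL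
    have e1 : L[1] = p := by simp [← hA]
    have e2 : L[m + 4] = p := by
      have : m + 4 = B.length + 1 := by omega
      simp [← hB, this]
    rw [e1, e2]
  let c : Fin (m + 3) → α := fun i => L[i.val]
  have c1 : ∀ i : Fin (m + 3), c (i + 1) = L[i.val + 1] := by
    intro i
    have hv : (i + 1).val = (i.val + 1) % (m + 3) := by simp [Fin.val_add]
    simp only [c, hv]
    rcases Nat.lt_or_ge (i.val + 1) (m + 3) with h | h
    · simp only [Nat.mod_eq_of_lt h]
    · have : i.val + 1 = m + 3 := by omega
      simp only [this, Nat.mod_self]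
      exact (w0 (by omega)).symm
  have c2 : ∀ i : Fin (m + 3), c (i + 1 + 1) = L[i.val + 2] := by
    intro i
    have hv : (i + 1 + 1).val = (i.val + 2) % (m + 3) := by simp [Fin.val_add, add_assoc]
    simp only [c, hv]
    rcases Nat.lt_or_ge (i.val + 2) (m + 3) with h | h
    · simp only [Nat.mod_eq_of_lt h]
    · rcases Nat.lt_or_ge (m + 3) (i.val + 2) with h' | h'
      · have : i.val + 2 = m + 4 := by omega
        have h4 : (m + 4) % (m + 3) = 1 := by
          rw [show m + 4 = 1 + (m + 3) by omega, Nat.add_mod_right, Nat.mod_eq_of_lt (by omega)]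
        simp only [this, h4]
        exact (w1 (by omega)).symm
      · have : i.val + 2 = m + 3 := by omega
        simp only [this, Nat.mod_self]
        exact (w0 (by omega)).symm
  have hpat : ∀ i : Fin (m + 3), (tri L)[i.val] = (c (i + 1), s(c i, c (i + 1 + 1))) := by
    intro i
    rw [c1, c2, tri_get L i.val (by omega)]
  have hinj : ∀ i j : Fin (m + 3), c (i + 1) = c (j + 1) →
      s(c i, c (i + 1 + 1)) = s(c j, c (j + 1 + 1)) → i = j := by
    intro i j h h'
    have : (tri L)[i.val] = (tri L)[j.val] := by rw [hpat, hpat, h, h']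
    exact Fin.ext ((g.nd.getElem_inj_iff).1 this)
  refine ⟨m, c, ?_, ?_, ?_⟩
  · intro i j h h'
    have := hinj (i - 1) (j - 1) (by simpa using h) (by simpa using h')
    simpa using this
  · intro i
    apply g.hp (c i) (c (i + 1)) (c (i + 1 + 1))
    rw [← hpat]
    exact List.getElem_mem _
  · intro a b d ha hd
    obtain ⟨i, hi, e⟩ := List.getElem_of_mem (hf a b d ha hd)
    rw [hpat ⟨i, by omega⟩] at e
    simp only [Prod.mk.injEq] at e
    refine ⟨⟨i, by omega⟩ + 1, e.1, ?_⟩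
    rw [add_sub_cancel_right]
    exact e.2

theorem exists_H (s : ℕ) (hs : 3 ≤ s) : ∃ H : SimpleGraph (Fin s × Fin (s.choose 2)),
    H.Connected ∧ (∀ u, ∃ v w, v ≠ w ∧ ∀ y, H.Adj u y ↔ y = v ∨ y = w) ∧
    (∀ u v, H.Adj u v → u.1 ≠ v.1) ∧
    (∀ u v, u.1 = v.1 → (∀ d, (∃ y, H.Adj u y ∧ y.1 = d) ↔ (∃ y, H.Adj v y ∧ y.1 = d)) → u = v) := by
  obtain ⟨m, c, hinj, hprop, hsurj⟩ := exists_cyc (α := Fin s) (o := ⟨0, by omega⟩)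
    (p := ⟨1, by omega⟩) (q := ⟨2, by omega⟩) (by simp) (by simp) (by simp)
  have hprop' : ∀ i, c (i - 1) ≠ c i := fun i => by simpa using hprop (i - 1)
  have hcard : ∀ b, Fintype.card {i // c i = b} = s.choose 2 := by
    intro b
    have h1 : ((Finset.univ.erase b : Finset (Fin s)).sym2).card = s.choose 2 := by
      rw [Finset.card_sym2, Finset.card_erase_of_mem (Finset.mem_univ _), Finset.card_univ,
        Fintype.card_fin]
      congr 1; omega
    rw [← h1, Fintype.card_subtype]
    refine Finset.card_bij (fun i _ => s(c (i - 1), c (i + 1))) ?_ ?_ ?_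
    · intro i hi
      simp only [Finset.mem_filter, Finset.mem_univ, true_and] at hi
      subst hi
      simp only [Finset.mk_mem_sym2_iff, Finset.mem_erase, Finset.mem_univ, and_true]
      exact ⟨hprop' i, (hprop i).symm⟩
    · intro i hi j hj h
      simp only [Finset.mem_filter, Finset.mem_univ, true_and] at hi hj
      exact hinj i j (hi.trans hj.symm) h
    · intro t
      induction t using Sym2.ind with
      | _ a d =>
      intro ht
      simp only [Finset.mk_mem_sym2_iff, Finset.mem_erase, Finset.mem_univ, and_true] at ht
      obtain ⟨i, hi, h⟩ := hsurj a b d ht.1 ht.2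
      exact ⟨i, by simpa using hi, h⟩
  let e : Fin (m + 3) ≃ Fin s × Fin (s.choose 2) :=
    ((Equiv.sigmaFiberEquiv c).symm.trans
      (Equiv.sigmaCongrRight (fun b => Fintype.equivFinOfCardEq (hcard b)))).trans
      (Equiv.sigmaEquivProd _ _)
  have he : ∀ i, (e i).1 = c i := fun i => rfl
  have hadj : ∀ i y, ((cycleGraph (m + 3)).comap e.symm).Adj (e i) y ↔
      y = e (i - 1) ∨ y = e (i + 1) := by
    intro i y
    rw [SimpleGraph.comap_adj, Equiv.symm_apply_apply, cycleGraph_adj, ← Equiv.symm_apply_eq,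
      ← Equiv.symm_apply_eq]
    generalize e.symm y = j
    constructor
    · rintro (h | h)
      · left; rw [← h]; abel
      · right; rw [← h]; abel
    · rintro (h | h)
      · left; rw [h]; abel
      · right; rw [h]; abel
  refine ⟨(cycleGraph (m + 3)).comap e.symm, ?_, ?_, ?_, ?_⟩
  · rw [(SimpleGraph.Iso.comap e.symm (cycleGraph (m + 3))).connected_iff]
    exact cycleGraph_connected
  · intro u
    obtain ⟨i, rfl⟩ := e.surjective u
    refine ⟨e (i - 1), e (i + 1), ?_, hadj i⟩
    intro h
    have h := e.injective h
    rw [sub_eq_iff_eq_add, add_assoc, left_eq_add] at h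
    simp [Fin.ext_iff, Fin.val_add] at h
    rw [Nat.mod_eq_of_lt (by omega)] at h
    omega
  · intro u v
    obtain ⟨i, rfl⟩ := e.surjective u
    rw [hadj]
    rintro (rfl | rfl)
    · exact (hprop' i).symm
    · exact hprop i
  · intro u v
    obtain ⟨i, rfl⟩ := e.surjective u
    obtain ⟨j, rfl⟩ := e.surjective v
    intro h hc
    have hc' : ∀ d, (d = c (i - 1) ∨ d = c (i + 1)) ↔ (d = c (j - 1) ∨ d = c (j + 1)) := by
      intro d
      have := hc d
      simp only [hadj, or_and_right, exists_or, exists_eq_left, he] at this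
      simpa only [eq_comm] using this
    rw [hinj i j h]
    rw [Sym2.eq_iff]
    have a1 := hc' (c (i - 1))
    have a2 := hc' (c (i + 1))
    have a3 := hc' (c (j - 1))
    have a4 := hc' (c (j + 1))
    grind

def bigG {D s M : ℕ} (H : SimpleGraph (Fin s × Fin M)) :
    SimpleGraph (Fin D × (Fin D → Fin s) × Fin M) where
  Adj u v := (u.1 ≠ v.1 ∧ u.2 = v.2) ∨
    (u.1 = v.1 ∧ (∀ l, l ≠ u.1 → u.2.1 l = v.2.1 l) ∧
      H.Adj (u.2.1 u.1, u.2.2) (v.2.1 v.1, v.2.2))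
  symm := ⟨by
    rintro ⟨i, x, m⟩ ⟨j, y, m'⟩ (⟨h1, h2⟩ | ⟨h1, h2, h3⟩)
    · exact Or.inl ⟨h1.symm, h2.symm⟩
    · dsimp at h1 h2 h3
      subst h1
      exact Or.inr ⟨rfl, fun l hl => (h2 l hl).symm, h3.symm⟩⟩
  loopless := ⟨by
    rintro ⟨i, x, m⟩ (⟨h1, h2⟩ | ⟨h1, h2, h3⟩)
    · exact h1 rfl
    · exact H.loopless.irrefl _ h3⟩

theorem bigG_connected {D s M : ℕ} (hD : 1 ≤ D) (H : SimpleGraph (Fin s × Fin M))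
    (hc : H.Connected) : (bigG (D := D) H).Connected := by
  have R1 : ∀ (i j : Fin D) x m, (bigG (D := D) H).Reachable (i, x, m) (j, x, m) := by
    intro i j x m
    by_cases h : i = j
    · rw [h]
    · exact SimpleGraph.Adj.reachable (Or.inl ⟨h, rfl⟩)
  have R2 : ∀ (i : Fin D) x m a m', (bigG (D := D) H).Reachable (i, x, m)
      (i, Function.update x i a, m') := by
    intro i x m a m'
    let φ : H →g bigG (D := D) H :=
      { toFun := fun p => (i, Function.update x i p.1, p.2)
        map_rel' := by
          intro p q h
          refine Or.inr ⟨rfl, ?_, ?_⟩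
          · intro l hl
            dsimp at hl ⊢
            rw [Function.update_of_ne hl, Function.update_of_ne hl]
          · simpa using h }
    have h : (bigG (D := D) H).Reachable (i, Function.update x i (x i), m)
        (i, Function.update x i a, m') := (hc.preconnected (x i, m) (a, m')).map φ
    rwa [Function.update_eq_self] at h
  have R3 : ∀ (S : Finset (Fin D)) i x y m, (bigG (D := D) H).Reachable (i, x, m)
      (i, S.piecewise y x, m) := by
    intro S i x y m
    induction S using Finset.induction_on with
    | empty => simp
    | insert j S hj ih =>
      rw [Finset.piecewise_insert]
      exact ih.trans ((R1 i j _ _).trans ((R2 j _ _ _ _).trans (R1 j i _ _)))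
  have hne : Nonempty (Fin D × (Fin D → Fin s) × Fin M) := by
    obtain ⟨a, m⟩ := hc.nonempty.some
    exact ⟨(⟨0, hD⟩, fun _ => a, m)⟩
  refine ⟨?_⟩
  rintro ⟨i, x, m⟩ ⟨j, y, m'⟩
  have h3 := R3 Finset.univ i x y m
  rw [Finset.piecewise_univ] at h3
  have h2 := R2 j y m (y j) m'
  rw [Function.update_eq_self] at h2
  exact h3.trans ((R1 i j _ _).trans h2)

theorem bigG_degree {D s M : ℕ} (hD : 1 ≤ D) (H : SimpleGraph (Fin s × Fin M))
    (hdeg : ∀ u, ∃ v w, v ≠ w ∧ ∀ y, H.Adj u y ↔ y = v ∨ y = w)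
    [DecidableRel (bigG (D := D) H).Adj] (u) : (bigG (D := D) H).degree u = D + 1 := by
  obtain ⟨i, x, m⟩ := u
  obtain ⟨v, w, hvw, hadj⟩ := hdeg (x i, m)
  have key : (bigG (D := D) H).neighborFinset (i, x, m) =
      ((Finset.univ.erase i).image (fun j => (j, x, m))) ∪
      ({v, w} : Finset (Fin s × Fin M)).image (fun p => (i, Function.update x i p.1, p.2)) := by
    ext ⟨j, y, m'⟩
    rw [SimpleGraph.mem_neighborFinset, Finset.mem_union, Finset.mem_image, Finset.mem_image]
    refine or_congr ?_ ?_
    · constructor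
      · rintro ⟨h1, h2⟩
        exact ⟨j, by simpa using Ne.symm h1, by rw [Prod.mk.injEq]; exact ⟨rfl, h2⟩⟩
      · rintro ⟨j', h1, h2⟩
        simp only [Prod.mk.injEq] at h2
        obtain ⟨rfl, rfl, rfl⟩ := h2
        exact ⟨by simpa [eq_comm] using h1, rfl⟩
    · constructor
      · rintro ⟨h1, h2, h3⟩
        dsimp at h1 h2 h3
        subst h1
        refine ⟨(y i, m'), by simpa using (hadj _).1 h3, ?_⟩
        simp only [Prod.mk.injEq, true_and, and_true]
        funext l
        by_cases hl : l = i
        · subst hl; simp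
        · rw [Function.update_of_ne hl]; exact h2 l hl
      · rintro ⟨p, h1, h2⟩
        simp only [Prod.mk.injEq] at h2
        obtain ⟨rfl, rfl, rfl⟩ := h2
        refine ⟨rfl, ?_, ?_⟩
        · intro l hl
          dsimp at hl ⊢
          rw [Function.update_of_ne hl]
        · have := (hadj p).2 (by simpa using h1)
          simpa using this
  rw [← SimpleGraph.card_neighborFinset_eq_degree, key, Finset.card_union_of_disjoint,
    Finset.card_image_of_injective, Finset.card_image_of_injective,
    Finset.card_erase_of_mem (Finset.mem_univ _), Finset.card_pair hvw, Finset.card_univ,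
    Fintype.card_fin]
  · omega
  · intro p q h
    simp only [Prod.mk.injEq, true_and] at h
    refine Prod.ext ?_ h.2
    simpa using congrFun h.1 i
  · intro p q h
    simp only [Prod.mk.injEq] at h
    exact h.1
  · rw [Finset.disjoint_left]
    intro t h1 h2
    simp only [Finset.mem_image, Finset.mem_erase] at h1 h2
    obtain ⟨j, hj, rfl⟩ := h1
    obtain ⟨p, _, h⟩ := h2
    simp only [Prod.mk.injEq] at h
    exact hj.1 h.1.symm

theorem bigG_NL {D s M : ℕ} (H : SimpleGraph (Fin s × Fin M))
    (h3 : ∀ u v, H.Adj u v → u.1 ≠ v.1)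
    (h4 : ∀ u v, u.1 = v.1 →
      (∀ d, (∃ y, H.Adj u y ∧ y.1 = d) ↔ (∃ y, H.Adj v y ∧ y.1 = d)) → u = v) :
    IsNLColoring (bigG (D := D) H) (D * s) (fun u => finProdFinEquiv (u.1, u.2.1 u.1)) := by
  have sub : ∀ (i : Fin D) x m d, (∃ y, H.Adj (x i, m) y ∧ y.1 = d) ↔
      finProdFinEquiv (i, d) ∈ colorNbrs (bigG (D := D) H)
        (fun u => finProdFinEquiv (u.1, u.2.1 u.1)) (i, x, m) := by
    intro i x m d
    constructor
    · rintro ⟨⟨a, m'⟩, h, rfl⟩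
      refine ⟨(i, Function.update x i a, m'), Or.inr ⟨rfl, ?_, ?_⟩, ?_⟩
      · intro l hl
        dsimp at hl ⊢
        rw [Function.update_of_ne hl]
      · simpa using h
      · simp
    · rintro ⟨⟨j, y, m'⟩, h, e⟩
      simp only [EmbeddingLike.apply_eq_iff_eq, Prod.mk.injEq] at e
      obtain ⟨rfl, rfl⟩ := e
      rcases h with ⟨h, _⟩ | ⟨_, _, h⟩
      · exact absurd rfl h
      · exact ⟨_, h, rfl⟩
  constructor
  · rintro ⟨i, x, m⟩ ⟨j, y, m'⟩ h e
    simp only [EmbeddingLike.apply_eq_iff_eq, Prod.mk.injEq] at e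
    rcases h with ⟨h, _⟩ | ⟨_, _, h⟩
    · exact h e.1
    · exact h3 _ _ h e.2
  · rintro ⟨i, x, m⟩ ⟨j, y, m'⟩ hne e hN
    simp only [EmbeddingLike.apply_eq_iff_eq, Prod.mk.injEq] at e
    obtain ⟨rfl, e⟩ := e
    have hxy : x = y := by
      funext l
      by_cases hl : l = i
      · rw [hl]; exact e
      · have : finProdFinEquiv (l, x l) ∈ colorNbrs (bigG (D := D) H)
            (fun u => finProdFinEquiv (u.1, u.2.1 u.1)) (i, x, m) :=
          ⟨(l, x, m), Or.inl ⟨Ne.symm hl, rfl⟩, rfl⟩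
        rw [hN] at this
        obtain ⟨⟨j, z, m''⟩, h, e'⟩ := this
        simp only [EmbeddingLike.apply_eq_iff_eq, Prod.mk.injEq] at e'
        obtain ⟨rfl, e'⟩ := e'
        rcases h with ⟨_, h⟩ | ⟨h, _⟩
        · simp only [Prod.mk.injEq] at h
          rw [← e', h.1]
        · exact absurd h.symm hl
    subst hxy
    apply hne
    have := h4 (x i, m) (x i, m') rfl (fun d => by rw [sub, sub, hN])
    simp only [Prod.mk.injEq, true_and] at this
    rw [this]

/-- For all `Δ ≥ 2` and `s ≥ 4` there is a finite connected graph `G` of maximum degree `Δ`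
with `χ_NL(G) ≤ (Δ-1)·s` and at least `(5/32)·Δ·s^(Δ+1)` vertices; in particular, with
`k = χ_NL(G)`, the order of `G` is at least `(5/32)·Δ·(k/(Δ-1))^(Δ+1)`. -/
theorem stmt8 (Δ s : ℕ) (hΔ : 2 ≤ Δ) (hs : 4 ≤ s) :
    ∃ (V : Type) (_ : Fintype V) (G : SimpleGraph V) (_ : DecidableRel G.Adj),
      G.Connected ∧ G.maxDegree = Δ ∧
      nlChrom G ≤ (Δ - 1) * s ∧
      (5 : ℝ) / 32 * Δ * (s : ℝ) ^ (Δ + 1) ≤ (Fintype.card V : ℝ) ∧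
      (5 : ℝ) / 32 * Δ * ((nlChrom G : ℝ) / ((Δ : ℝ) - 1)) ^ (Δ + 1) ≤ (Fintype.card V : ℝ) := by
  classical
  obtain ⟨D, rfl⟩ : ∃ D, Δ = D + 1 := ⟨Δ - 1, by omega⟩
  have hD : 1 ≤ D := by omega
  obtain ⟨H, h1, h2, h3, h4⟩ := exists_H s (by omega)
  have hchrom : nlChrom (bigG (D := D) H) ≤ D * s := Nat.sInf_le ⟨_, bigG_NL H h3 h4⟩
  have hconn := bigG_connected hD H h1
  have hcard : (5 : ℝ) / 32 * ((D + 1 : ℕ) : ℝ) * (s : ℝ) ^ (D + 1 + 1) ≤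
      (Fintype.card (Fin D × (Fin D → Fin s) × Fin (s.choose 2)) : ℝ) := by
    simp only [Fintype.card_prod, Fintype.card_fin, Fintype.card_fun]
    push_cast
    rw [Nat.cast_choose_two]
    have hD' : (1 : ℝ) ≤ D := by exact_mod_cast hD
    have hs' : (4 : ℝ) ≤ s := by exact_mod_cast hs
    have hpos : (0 : ℝ) ≤ (s : ℝ) ^ (D + 1) := by positivity
    have hk : 5 * ((D : ℝ) + 1) * s ≤ 16 * D * (s - 1) := by nlinarith
    calc (5 : ℝ) / 32 * (D + 1) * (s : ℝ) ^ (D + 1 + 1)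
        = (s : ℝ) ^ (D + 1) * (5 * ((D : ℝ) + 1) * s) / 32 := by ring
      _ ≤ (s : ℝ) ^ (D + 1) * (16 * D * (s - 1)) / 32 := by gcongr
      _ = _ := by ring
  refine ⟨_, inferInstance, bigG (D := D) H, inferInstance, hconn, ?_, by simpa using hchrom,
    hcard, le_trans ?_ hcard⟩
  · have := hconn.nonempty
    obtain ⟨v, hv⟩ := (bigG (D := D) H).exists_maximal_degree_vertex
    rw [hv, bigG_degree hD H h2]
  · have hD' : (0 : ℝ) < D := by exact_mod_cast hD
    have e : (((D + 1 : ℕ) : ℝ) - 1) = D := by push_cast; ring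
    rw [e]
    gcongr
    rw [div_le_iff₀ hD']
    calc (nlChrom (bigG (D := D) H) : ℝ) ≤ ((D * s : ℕ) : ℝ) := by exact_mod_cast hchrom
      _ = s * D := by push_cast; ring
end

section
/- Let p and q be positive integers with p < q, and let V = {(i, j) : 1 ≤ i ≤ p, 1 ≤ j ≤ q}, where the second coordinate of an element is called its column. Then there exists a matching M (a set of unordered pairs of distinct elements of V such that every element of V belongs to at most one pair) satisfying: (i) the two elements of each pair of M lie in different columns; (ii) for any two distinct pairs {a, b} and {c, d} of M, if a and c lie in the same column then b and d lie in distinct columns; (iii) for each column j, at most one element of V with column j is not covered by M. -/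
def RR (p q : ℕ) (a b : Fin p × Fin q) : Prop :=
  ∃ t : ℕ, a.1.val = 2 * t ∧ b.1.val = 2 * t + 1 ∧
    (b.2.val = a.2.val + t + 1 ∨ b.2.val + q = a.2.val + t + 1)

/-- Lemma 9 (matrix matching): for `p < q`, on the entries of a `p × q` matrix
(identified with `Fin p × Fin q`, the column being the second coordinate) there is a
matching (a set of unordered pairs of distinct entries, pairwise disjoint) such that:
(i) the two endpoints of each pair are in different columns;
(ii) for two distinct pairs, if one endpoint of each lies in the same column, then the
other endpoints lie in distinct columns;
(iii) in each column, at most one entry is left uncovered. -/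
theorem stmt9 (p q : ℕ) (hp : 0 < p) (hpq : p < q) :
    ∃ M : Set (Sym2 (Fin p × Fin q)),
      (∀ e ∈ M, ¬ e.IsDiag) ∧
      (∀ e ∈ M, ∀ e' ∈ M, e ≠ e' → ∀ v : Fin p × Fin q, v ∈ e → v ∉ e') ∧
      (∀ e ∈ M, ∀ a b : Fin p × Fin q, e = s(a, b) → a.2 ≠ b.2) ∧
      (∀ e ∈ M, ∀ e' ∈ M, e ≠ e' →
        ∀ a b c d : Fin p × Fin q, e = s(a, b) → e' = s(c, d) → a.2 = c.2 → b.2 ≠ d.2) ∧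
      (∀ j : Fin q, ∀ v w : Fin p × Fin q, v.2 = j → w.2 = j →
        (∀ e ∈ M, v ∉ e) → (∀ e ∈ M, w ∉ e) → v = w) := by
  have ex : ∀ x y : Fin p × Fin q, x.1.val = y.1.val → x.2.val = y.2.val → x = y :=
    fun x y h1 h2 => Prod.ext (Fin.ext h1) (Fin.ext h2)
  have ne : ∀ a b, RR p q a b → a.2 ≠ b.2 := by
    rintro a b ⟨t, h1, h2, h3⟩ h
    have := congrArg Fin.val h
    have := b.1.isLt
    omega
  have i1 : ∀ a b c, RR p q a b → RR p q a c → b = c := by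
    rintro a b c ⟨t, h1, h2, h3⟩ ⟨t', h1', h2', h3'⟩
    have := b.2.isLt
    have := c.2.isLt
    apply ex <;> omega
  have i2 : ∀ a b c, RR p q a c → RR p q b c → a = b := by
    rintro a b c ⟨t, h1, h2, h3⟩ ⟨t', h1', h2', h3'⟩
    have := a.2.isLt
    have := b.2.isLt
    apply ex <;> omega
  have i3 : ∀ a b c, RR p q a b → RR p q b c → False := by
    rintro a b c ⟨t, h1, h2, h3⟩ ⟨t', h1', h2', h3'⟩
    omega
  have j1 : ∀ a b c d, RR p q a b → RR p q c d → a.2 = c.2 → b.2 = d.2 → a = c ∧ b = d := by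
    rintro a b c d ⟨t, h1, h2, h3⟩ ⟨t', h1', h2', h3'⟩ h h'
    have := congrArg Fin.val h
    have := congrArg Fin.val h'
    have := b.1.isLt
    have := d.1.isLt
    have : t = t' := by omega
    constructor <;> apply ex <;> omega
  have j2 : ∀ a b c d, RR p q a b → RR p q c d → a.2 = d.2 → b.2 = c.2 → False := by
    rintro a b c d ⟨t, h1, h2, h3⟩ ⟨t', h1', h2', h3'⟩ h h'
    have := congrArg Fin.val h
    have := congrArg Fin.val h'
    have := b.1.isLt
    have := d.1.isLt
    omega
  have cov : ∀ v : Fin p × Fin q, (∀ e, (∃ a b, RR p q a b ∧ e = s(a, b)) → v ∉ e) →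
      v.1.val + 1 = p := by
    intro v hv
    by_contra hne
    have l1 := v.1.isLt
    have l2 := v.2.isLt
    rcases Nat.even_or_odd' v.1.val with ⟨t, ht | ht⟩
    · by_cases hc : v.2.val + t + 1 < q
      · exact hv _ ⟨v, (⟨2 * t + 1, by omega⟩, ⟨v.2.val + t + 1, hc⟩),
          ⟨t, ht, rfl, Or.inl rfl⟩, rfl⟩ (Sym2.mem_mk_left _ _)
      · exact hv _ ⟨v, (⟨2 * t + 1, by omega⟩, ⟨v.2.val + t + 1 - q, by omega⟩),
          ⟨t, ht, rfl, Or.inr (by simp only []; omega)⟩, rfl⟩ (Sym2.mem_mk_left _ _)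
    · by_cases hc : t + 1 ≤ v.2.val
      · exact hv _ ⟨(⟨2 * t, by omega⟩, ⟨v.2.val - (t + 1), by omega⟩), v,
          ⟨t, rfl, ht, Or.inl (by simp only []; omega)⟩, rfl⟩ (Sym2.mem_mk_right _ _)
      · exact hv _ ⟨(⟨2 * t, by omega⟩, ⟨v.2.val + q - (t + 1), by omega⟩), v,
          ⟨t, rfl, ht, Or.inr (by simp only []; omega)⟩, rfl⟩ (Sym2.mem_mk_right _ _)
  refine ⟨{e | ∃ a b, RR p q a b ∧ e = s(a, b)}, ?_, ?_, ?_, ?_, ?_⟩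
  · rintro e ⟨a, b, h, rfl⟩ hd
    exact ne a b h (congrArg Prod.snd (Sym2.mk_isDiag_iff.1 hd))
  · rintro e ⟨a, b, h, rfl⟩ e' ⟨c, d, h', rfl⟩ hn v hv hv'
    apply hn
    rcases Sym2.mem_iff.1 hv with rfl | rfl <;> rcases Sym2.mem_iff.1 hv' with rfl | rfl
    · rw [i1 _ _ _ h h']
    · exact (i3 _ _ _ h' h).elim
    · exact (i3 _ _ _ h h').elim
    · rw [i2 _ _ _ h h']
  · rintro e ⟨a, b, h, rfl⟩ x y he
    rcases Sym2.eq_iff.1 he with ⟨rfl, rfl⟩ | ⟨rfl, rfl⟩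
    · exact ne _ _ h
    · exact (ne _ _ h).symm
  · rintro e ⟨a, b, h, rfl⟩ e' ⟨c, d, h', rfl⟩ hn x y z w he he' h1 h2
    apply hn
    rcases Sym2.eq_iff.1 he with ⟨rfl, rfl⟩ | ⟨rfl, rfl⟩ <;>
      rcases Sym2.eq_iff.1 he' with ⟨rfl, rfl⟩ | ⟨rfl, rfl⟩
    · obtain ⟨r, r'⟩ := j1 _ _ _ _ h h' h1 h2
      rw [r, r']
    · exact (j2 _ _ _ _ h h' h1 h2).elim
    · exact (j2 _ _ _ _ h h' h2 h1).elim
    · obtain ⟨r, r'⟩ := j1 _ _ _ _ h h' h2 h1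
      rw [r, r']
  · intro j v w hv hw h h'
    have := cov v h
    have := cov w h'
    exact Prod.ext (Fin.ext (by omega)) (hv.trans hw.symm)
end

section
/- Let p, q, s' be positive integers with p < q. Let G be a finite simple graph containing an independent set M = {m_{ij} : 1 ≤ i ≤ p, 1 ≤ j ≤ q} of p·q distinct vertices, and let φ be a proper coloring of G with colors {1,...,s'+q} such that: (i) every color in {1,...,s'} is assigned to some vertex of V(G) \ M; (ii) a vertex x satisfies s'+1 ≤ φ(x) ≤ s'+q if and only if x ∈ M; (iii) any two distinct vertices x, y not both belonging to M are neighbor-distinguished with respect to φ; (iv) φ(m_{ij}) = s' + j for all i, j. Then there exists a set F of edges, each joining two vertices of M and together forming a matching on M (each vertex of M is incident to at most one edge of F), such that φ is a neighbor-locating (s'+q)-coloring of the spanning supergraph G' obtained from G by adding the edges of F. -/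
open SimpleGraph

/-- Corollary: given an independent `p × q` grid `M` of vertices (with `p < q`) and a
proper `(s'+q)`-coloring `φ` satisfying the hypotheses (i)-(iv), one can add a matching
between the vertices of `M` so that `φ` becomes a neighbor-locating `(s'+q)`-coloring of
the resulting spanning supergraph. -/
theorem stmt10 {V : Type*} [Fintype V] (G : SimpleGraph V)
    (p q s' : ℕ) (hp : 0 < p) (hs' : 0 < s') (hpq : p < q)
    (m : Fin p × Fin q → V) (hm : Function.Injective m)
    (hindep : ∀ a b : Fin p × Fin q, ¬ G.Adj (m a) (m b))
    (φ : V → Fin (s' + q))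
    (hproper : ∀ u v, G.Adj u v → φ u ≠ φ v)
    (h1 : ∀ c : Fin (s' + q), (c : ℕ) < s' → ∃ x, x ∉ Set.range m ∧ φ x = c)
    (h2 : ∀ x : V, s' ≤ ((φ x : ℕ)) ↔ x ∈ Set.range m)
    (h3 : ∀ x y : V, x ≠ y → ¬ (x ∈ Set.range m ∧ y ∈ Set.range m) →
      φ x ≠ φ y ∨ colorNbrs G φ x ≠ colorNbrs G φ y)
    (h4 : ∀ i : Fin p, ∀ j : Fin q, ((φ (m (i, j)) : ℕ)) = s' + (j : ℕ)) :
    ∃ G' : SimpleGraph V,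
      G ≤ G' ∧
      (∀ u v, G'.Adj u v → ¬ G.Adj u v → u ∈ Set.range m ∧ v ∈ Set.range m) ∧
      (∀ u v w, G'.Adj u v → ¬ G.Adj u v → G'.Adj u w → ¬ G.Adj u w → v = w) ∧
      IsNLColoring G' (s' + q) φ := by
  haveI : NeZero q := ⟨by omega⟩
  let ι : Fin p → Fin q := Fin.castLE hpq.le
  have hι : Function.Injective ι := Fin.castLE_injective hpq.le
  have hcol : ∀ i j i' j', φ (m (i, j)) = φ (m (i', j')) → j = j' := by
    intro i j i' j' h
    have a := h4 i j
    have b := h4 i' j'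
    rw [h] at a
    apply Fin.ext
    omega
  let G' : SimpleGraph V :=
    { Adj := fun u v => G.Adj u v ∨ ∃ i j, u = m (i, j) ∧ v = m (i, ι i - j) ∧ ι i - j ≠ j
      symm := ⟨by
        rintro u v (h | ⟨i, j, hu, hv, hne⟩)
        · exact Or.inl h.symm
        · refine Or.inr ⟨i, ι i - j, hv, ?_, ?_⟩
          · rw [sub_sub_cancel]; exact hu
          · rw [sub_sub_cancel]; exact hne.symm⟩
      loopless := ⟨by
        rintro u (h | ⟨i, j, hu, hv, hne⟩)
        · exact G.loopless.irrefl _ h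
        · have := hm (hu.symm.trans hv)
          simp only [Prod.mk.injEq, true_and] at this
          exact hne this.symm⟩ }
  have hadj : ∀ u v, G'.Adj u v ↔
      (G.Adj u v ∨ ∃ i j, u = m (i, j) ∧ v = m (i, ι i - j) ∧ ι i - j ≠ j) :=
    fun _ _ => Iff.rfl
  have key : ∀ i i' j, i ≠ i' → ι i - j ≠ j →
      colorNbrs G' φ (m (i, j)) ≠ colorNbrs G' φ (m (i', j)) := by
    intro i i' j hne hij heq
    have hmem : φ (m (i, ι i - j)) ∈ colorNbrs G' φ (m (i, j)) :=
      ⟨_, Or.inr ⟨i, j, rfl, rfl, hij⟩, rfl⟩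
    rw [heq] at hmem
    obtain ⟨y, hy, hc⟩ := hmem
    rcases (hadj _ _).1 hy with h | ⟨a, b, h, hy', -⟩
    · have : y ∈ Set.range m := by
        rw [← h2, hc, h4]
        omega
      obtain ⟨z, rfl⟩ := this
      exact hindep _ _ h
    · have h' := hm h
      simp only [Prod.mk.injEq] at h'
      obtain ⟨rfl, rfl⟩ := h'
      rw [hy'] at hc
      exact hne (hι (sub_left_injective (hcol _ _ _ _ hc))).symm
  have hout : ∀ u, u ∉ Set.range m → colorNbrs G' φ u = colorNbrs G φ u := by
    intro u hu
    ext c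
    constructor
    · rintro ⟨y, hy, hc⟩
      rcases (hadj _ _).1 hy with h | ⟨a, b, h, -⟩
      · exact ⟨y, h, hc⟩
      · exact absurd ⟨_, h.symm⟩ hu
    · rintro ⟨y, hy, hc⟩
      exact ⟨y, Or.inl hy, hc⟩
  refine ⟨G', fun u v h => Or.inl h, ?_, ?_, ?_, ?_⟩
  · rintro u v h hn
    rcases (hadj _ _).1 h with h | ⟨i, j, rfl, rfl, -⟩
    · exact absurd h hn
    · exact ⟨⟨_, rfl⟩, ⟨_, rfl⟩⟩
  · rintro u v w h hn h' hn'
    rcases (hadj _ _).1 h with h | ⟨i, j, hu, rfl, -⟩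
    · exact absurd h hn
    rcases (hadj _ _).1 h' with h' | ⟨a, b, hu', rfl, -⟩
    · exact absurd h' hn'
    have e := hm (hu.symm.trans hu')
    simp only [Prod.mk.injEq] at e
    obtain ⟨rfl, rfl⟩ := e
    rfl
  · rintro u v h
    rcases (hadj _ _).1 h with h | ⟨i, j, rfl, rfl, hne⟩
    · exact hproper _ _ h
    · exact fun h => hne (hcol _ _ _ _ h).symm
  · intro u v huv hc
    by_cases hu : u ∈ Set.range m
    · have hv : v ∈ Set.range m := by
        rw [← h2, ← hc, h2]; exact hu
      obtain ⟨⟨i, j⟩, rfl⟩ := hu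
      obtain ⟨⟨i', j'⟩, rfl⟩ := hv
      obtain rfl := hcol _ _ _ _ hc
      have hii : i ≠ i' := fun h => huv (by rw [h])
      by_cases hij : ι i - j = j
      · have : ι i' - j ≠ j := fun h =>
          hii (hι (sub_left_injective (hij.trans h.symm)))
        exact (key i' i j hii.symm this).symm
      · exact key i i' j hii hij
    · have hv : v ∉ Set.range m := by
        rw [← h2, ← hc, h2]; exact hu
      rw [hout u hu, hout v hv]
      exact (h3 u v huv (fun h => hu h.1)).resolve_left (fun h => h hc)
end

section
/- Let G be a finite connected simple graph on n vertices. If the graph G* admits a neighbor-locating (n+3)-coloring, then G admits a proper 3-coloring. -/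
open SimpleGraph

/-- The vertex set of the graph `G*` built from a graph `G` on `n` vertices:
the original vertices `u_i`, the copies `u'_i`, the gadget centers `x_i`,
the gadget independent sets `A_i` (of size `n-1`) and `B_i` (of size `n+2`),
and the three vertices `y_1, y_2, y_3`. -/
inductive StarV (n : ℕ) : Type
  | orig : Fin n → StarV n
  | copy : Fin n → StarV n
  | gx : Fin n → StarV n
  | ga : Fin n → Fin (n - 1) → StarV n
  | gb : Fin n → Fin (n + 2) → StarV n
  | gy : Fin 3 → StarV n
  deriving DecidableEq, Fintype

/-- The base relation generating the edges of `G*`. -/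
def starRel {n : ℕ} (G : SimpleGraph (Fin n)) : StarV n → StarV n → Prop
  | .orig i, .orig j => G.Adj i j
  | .copy i, .copy j => G.Adj i j
  | .orig i, .copy j => G.Adj i j
  | .gx i, .ga i' _ => i = i'
  | .gx i, .gb i' _ => i = i'
  | .orig i, .ga i' _ => i = i'
  | .copy i, .ga i' _ => i = i'
  | .gy _, .ga _ _ => True
  | .gy _, .gx _ => True
  | _, _ => False

/-- The graph `G*` constructed from `G`. -/
def GStar {n : ℕ} (G : SimpleGraph (Fin n)) : SimpleGraph (StarV n) :=
  SimpleGraph.fromRel (starRel G)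


theorem twins_ne {V : Type*} {G : SimpleGraph V} {k : ℕ} {f : V → Fin k}
    (hf : IsNLColoring G k f) {u v : V} (huv : u ≠ v)
    (h : ∀ w, G.Adj u w ↔ G.Adj v w) : f u ≠ f v := by
  intro he
  apply hf.2 u v huv he
  ext c
  simp [colorNbrs, h]

theorem key_range {n : ℕ} (G : SimpleGraph (Fin n)) (f : StarV n → Fin (n + 3))
    (hf : IsNLColoring (GStar G) (n + 3) f) (i : Fin n) (c : Fin (n + 3))
    (hc : ∀ a, c ≠ f (.ga i a)) : c = f (.gx i) ∨ ∃ y, c = f (.gy y) := by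
  have hxy : ∀ y, f (.gx i) ≠ f (.gy y) := fun y => hf.1 _ _ (by simp [GStar, starRel])
  have hxa : ∀ a, f (.gx i) ≠ f (.ga i a) := fun y => hf.1 _ _ (by simp [GStar, starRel])
  have hya : ∀ y a, f (.gy y) ≠ f (.ga i a) := fun y a => hf.1 _ _ (by simp [GStar, starRel])
  have hyy : ∀ y z, f (.gy y) = f (.gy z) → y = z := by
    intro y z h
    by_contra hne
    refine twins_ne hf (by simpa using hne) ?_ h
    intro w
    cases w <;> simp [GStar, starRel]
  have haa : ∀ y z, f (.ga i y) = f (.ga i z) → y = z := by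
    intro y z h
    by_contra hne
    refine twins_ne hf (by simpa using hne) ?_ h
    intro w
    cases w <;> simp [GStar, starRel]
  let g : Option (Fin 3 ⊕ Fin (n - 1)) → Fin (n + 3) := fun o =>
    match o with
    | none => f (.gx i)
    | some (.inl y) => f (.gy y)
    | some (.inr a) => f (.ga i a)
  have hg : Function.Injective g := by
    rintro (_ | y | a) (_ | z | b) h
    · rfl
    · exact absurd h (hxy z)
    · exact absurd h (hxa b)
    · exact absurd h.symm (hxy y)
    · rw [hyy _ _ h]
    · exact absurd h (hya y b)
    · exact absurd h.symm (hxa a)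
    · exact absurd h.symm (hya z a)
    · rw [haa _ _ h]
  have hn := i.pos
  have hb : Function.Bijective g := by
    rw [Fintype.bijective_iff_injective_and_card]
    refine ⟨hg, ?_⟩
    simp
    omega
  obtain ⟨o, ho⟩ := hb.2 c
  rcases o with _ | y | a
  · exact Or.inl ho.symm
  · exact Or.inr ⟨y, ho.symm⟩
  · exact absurd ho.symm (hc a)

/-- If `G*` admits a neighbor-locating `(n+3)`-coloring, where `G` is a connected graph on
`n` vertices, then `G` admits a proper 3-coloring. -/
theorem stmt12 {n : ℕ} (G : SimpleGraph (Fin n)) (hconn : G.Connected)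
    (h : ∃ f : StarV n → Fin (n + 3), IsNLColoring (GStar G) (n + 3) f) :
    G.Colorable 3 := by
  obtain ⟨f, hf⟩ := h
  have key : ∀ i, ∃ y, f (.orig i) = f (.gy y) ∨ f (.copy i) = f (.gy y) := by
    intro i
    have hne : f (.orig i) ≠ f (.copy i) := by
      refine twins_ne hf (by simp) ?_
      intro w
      cases w <;> simp [GStar, starRel, G.adj_comm] <;> grind [SimpleGraph.Adj.ne, G.adj_comm]
    rcases key_range G f hf i (f (.orig i)) (fun a => hf.1 _ _ (by simp [GStar, starRel])) with
      h1 | ⟨y, h1⟩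
    · rcases key_range G f hf i (f (.copy i)) (fun a => hf.1 _ _ (by simp [GStar, starRel])) with
        h2 | ⟨y, h2⟩
      · exact absurd (h1.trans h2.symm) hne
      · exact ⟨y, Or.inr h2⟩
    · exact ⟨y, Or.inl h1⟩
  choose c hc using key
  refine ⟨SimpleGraph.Coloring.mk c ?_⟩
  intro i j hij he
  have h1 := hc i
  have h2 := hc j
  rw [he] at h1
  have hn := hij.ne
  have e1 := hf.1 (.orig i) (.orig j) (by simp [GStar, starRel, hij, hn])
  have e2 := hf.1 (.orig i) (.copy j) (by simp [GStar, starRel, hij])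
  have e3 := hf.1 (.copy i) (.orig j) (by simp [GStar, starRel, hij.symm])
  have e4 := hf.1 (.copy i) (.copy j) (by simp [GStar, starRel, hij, hn])
  rcases h1 with h1 | h1 <;> rcases h2 with h2 | h2 <;> simp_all
end

section
/- Let G be a finite connected planar simple graph on n vertices with maximum degree at most 4. Then the graph G* has average degree at most 7; more precisely, G* has exactly 2n² + 4n + 3 vertices and at most 7n² + 7n edges. -/
open SimpleGraph

/-- Parametrization of the edges of `G*`. -/
def starEdge {n : ℕ} (G : SimpleGraph (Fin n)) :
    G.edgeSet ⊕ G.edgeSet ⊕ G.Dart ⊕ (Fin n × Fin (n - 1)) ⊕ (Fin n × Fin (n + 2)) ⊕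
      (Fin n × Fin (n - 1)) ⊕ (Fin n × Fin (n - 1)) ⊕ (Fin 3 × Fin n × Fin (n - 1)) ⊕
      (Fin 3 × Fin n) → Sym2 (StarV n)
  | .inl e => Sym2.map StarV.orig e.1
  | .inr (.inl e) => Sym2.map StarV.copy e.1
  | .inr (.inr (.inl d)) => s(StarV.orig d.fst, StarV.copy d.snd)
  | .inr (.inr (.inr (.inl p))) => s(StarV.gx p.1, StarV.ga p.1 p.2)
  | .inr (.inr (.inr (.inr (.inl p)))) => s(StarV.gx p.1, StarV.gb p.1 p.2)
  | .inr (.inr (.inr (.inr (.inr (.inl p))))) => s(StarV.orig p.1, StarV.ga p.1 p.2)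
  | .inr (.inr (.inr (.inr (.inr (.inr (.inl p)))))) => s(StarV.copy p.1, StarV.ga p.1 p.2)
  | .inr (.inr (.inr (.inr (.inr (.inr (.inr (.inl p))))))) =>
      s(StarV.gy p.1, StarV.ga p.2.1 p.2.2)
  | .inr (.inr (.inr (.inr (.inr (.inr (.inr (.inr p))))))) => s(StarV.gy p.1, StarV.gx p.2)

theorem starRel_range {n : ℕ} (G : SimpleGraph (Fin n)) (a b : StarV n)
    (h : starRel G a b) : s(a, b) ∈ Set.range (starEdge G) := by
  cases a <;> cases b <;> simp only [starRel] at h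
  case orig.orig i j => exact ⟨.inl ⟨s(i, j), h⟩, rfl⟩
  case copy.copy i j => exact ⟨.inr (.inl ⟨s(i, j), h⟩), rfl⟩
  case orig.copy i j => exact ⟨.inr (.inr (.inl ⟨(i, j), h⟩)), rfl⟩
  case gx.ga i j k => subst h; exact ⟨.inr (.inr (.inr (.inl (i, k)))), rfl⟩
  case gx.gb i j k => subst h; exact ⟨.inr (.inr (.inr (.inr (.inl (i, k))))), rfl⟩
  case orig.ga i j k => subst h; exact ⟨.inr (.inr (.inr (.inr (.inr (.inl (i, k)))))), rfl⟩
  case copy.ga i j k =>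
    subst h; exact ⟨.inr (.inr (.inr (.inr (.inr (.inr (.inl (i, k))))))), rfl⟩
  case gy.ga i j k =>
    exact ⟨.inr (.inr (.inr (.inr (.inr (.inr (.inr (.inl (i, j, k)))))))), rfl⟩
  case gy.gx i j =>
    exact ⟨.inr (.inr (.inr (.inr (.inr (.inr (.inr (.inr (i, j)))))))), rfl⟩

theorem starEdge_cover {n : ℕ} (G : SimpleGraph (Fin n)) :
    (GStar G).edgeSet ⊆ Set.range (starEdge G) := by
  intro e
  induction e with
  | _ a b =>
    intro h
    rw [SimpleGraph.mem_edgeSet, GStar, SimpleGraph.fromRel_adj] at h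
    rcases h.2 with h | h
    · exact starRel_range G a b h
    · rw [Sym2.eq_swap]; exact starRel_range G b a h

/-- `StarV n` as a sum type. -/
def starEquiv (n : ℕ) : StarV n ≃ Fin n ⊕ Fin n ⊕ Fin n ⊕ (Fin n × Fin (n - 1)) ⊕
    (Fin n × Fin (n + 2)) ⊕ Fin 3 where
  toFun
    | .orig i => .inl i
    | .copy i => .inr (.inl i)
    | .gx i => .inr (.inr (.inl i))
    | .ga i j => .inr (.inr (.inr (.inl (i, j))))
    | .gb i j => .inr (.inr (.inr (.inr (.inl (i, j)))))
    | .gy i => .inr (.inr (.inr (.inr (.inr i))))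
  invFun
    | .inl i => .orig i
    | .inr (.inl i) => .copy i
    | .inr (.inr (.inl i)) => .gx i
    | .inr (.inr (.inr (.inl p))) => .ga p.1 p.2
    | .inr (.inr (.inr (.inr (.inl p)))) => .gb p.1 p.2
    | .inr (.inr (.inr (.inr (.inr i)))) => .gy i
  left_inv x := by cases x <;> rfl
  right_inv x := by rcases x with x | x | x | x | x | x <;> rfl

/-- If `G` is a connected planar graph on `n` vertices with maximum degree at most 4, then
`G*` has exactly `2n² + 4n + 3` vertices, at most `7n² + 7n` edges and hence average
degree at most `7`. -/
theorem stmt14 {n : ℕ} (G : SimpleGraph (Fin n)) [DecidableRel G.Adj]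
    (hconn : G.Connected) (hplanar : IsPlanar G) (hdeg : ∀ v, G.degree v ≤ 4) :
    Fintype.card (StarV n) = 2 * n ^ 2 + 4 * n + 3 ∧
    (GStar G).edgeSet.ncard ≤ 7 * n ^ 2 + 7 * n ∧
    2 * (GStar G).edgeSet.ncard ≤ 7 * Fintype.card (StarV n) := by
  have hV : Fintype.card (StarV n) = 2 * n ^ 2 + 4 * n + 3 := by
    rw [Fintype.card_congr (starEquiv n)]
    simp only [Fintype.card_sum, Fintype.card_prod, Fintype.card_fin]
    rcases n with _ | n
    · rfl
    · simp only [Nat.add_sub_cancel]; ring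
  have hsum : ∑ v, G.degree v ≤ 4 * n := by
    calc ∑ v, G.degree v ≤ ∑ _v : Fin n, 4 := Finset.sum_le_sum fun v _ => hdeg v
      _ = 4 * n := by simp [mul_comm]
  have hD : Fintype.card G.Dart = ∑ v, G.degree v := G.dart_card_eq_sum_degrees
  have hE : 2 * Fintype.card G.edgeSet = ∑ v, G.degree v := by
    rw [G.sum_degrees_eq_twice_card_edges, SimpleGraph.edgeFinset_card]
  have hM : (GStar G).edgeSet.ncard ≤ 7 * n ^ 2 + 7 * n := by
    have h1 := Set.ncard_le_ncard (starEdge_cover G) (Set.finite_range _)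
    have h2 := Set.ncard_image_le (f := starEdge G) Set.finite_univ
    rw [Set.image_univ, Set.ncard_univ, Nat.card_eq_fintype_card] at h2
    simp only [Fintype.card_sum, Fintype.card_prod, Fintype.card_fin] at h2
    refine (h1.trans h2).trans ?_
    rcases n with _ | n
    · simp at *; omega
    · simp only [Nat.add_sub_cancel]
      nlinarith
  refine ⟨hV, hM, ?_⟩
  rw [hV]
  nlinarith
end

section
/- Let G be a finite connected planar simple graph on n vertices with maximum degree at most 4. Then the graph G* has maximum average degree at most 20, i.e., every subgraph of G* has average degree at most 20. -/
open SimpleGraph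

/-- The neighbours whose edge to the given vertex is charged to that vertex. -/
def outF {n : ℕ} (G : SimpleGraph (Fin n)) [DecidableRel G.Adj] : StarV n → Finset (StarV n)
  | .orig i => (G.neighborFinset i).image .orig ∪ (G.neighborFinset i).image .copy
  | .copy i => (G.neighborFinset i).image .orig ∪ (G.neighborFinset i).image .copy
  | .gx _ => Finset.univ.image .gy
  | .ga i _ => {.gx i, .orig i, .copy i} ∪ Finset.univ.image .gy
  | .gb i _ => {.gx i}
  | .gy _ => ∅

theorem outF_card {n : ℕ} (G : SimpleGraph (Fin n)) [DecidableRel G.Adj]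
    (hdeg : ∀ v, G.degree v ≤ 4) (v : StarV n) : (outF G v).card ≤ 10 := by
  have h3 : ((Finset.univ : Finset (Fin 3)).image (StarV.gy (n := n))).card ≤ 3 :=
    Finset.card_image_le
  have h4 (i : Fin n) (f : Fin n → StarV n) : ((G.neighborFinset i).image f).card ≤ 4 :=
    Finset.card_image_le.trans (hdeg i)
  cases v with
  | orig i =>
    have := h4 i .orig
    have := h4 i .copy
    exact (Finset.card_union_le _ _).trans (by omega)
  | copy i =>
    have := h4 i .orig
    have := h4 i .copy
    exact (Finset.card_union_le _ _).trans (by omega)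
  | gx i => exact h3.trans (by omega)
  | ga i k =>
    have : ({.gx i, .orig i, .copy i} : Finset (StarV n)).card ≤ 3 := Finset.card_le_three
    exact (Finset.card_union_le _ _).trans (by omega)
  | gb i k => simp [outF]
  | gy k => simp [outF]

theorem outF_cover {n : ℕ} (G : SimpleGraph (Fin n)) [DecidableRel G.Adj] (v w : StarV n)
    (h : starRel G v w) : w ∈ outF G v ∨ v ∈ outF G w := by
  cases v <;> cases w <;> simp_all [starRel, outF, G.adj_comm]

theorem stmt15 {n : ℕ} (G : SimpleGraph (Fin n)) [DecidableRel G.Adj]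
    (hconn : G.Connected) (hplanar : IsPlanar G) (hdeg : ∀ v, G.degree v ≤ 4) :
    ∀ H : (GStar G).Subgraph, H.verts.Nonempty →
      2 * H.edgeSet.ncard ≤ 20 * H.verts.ncard := by
  classical
  intro H _
  have hsub : H.edgeSet ⊆
      ((H.verts.toFinset.biUnion fun v => (outF G v).image fun w => s(v, w)) :
        Finset (Sym2 (StarV n))) := by
    intro e
    induction e using Sym2.ind with
    | _ v w =>
      intro he
      have hvw : H.Adj v w := he
      have key : w ∈ outF G v ∨ v ∈ outF G w := by
        rcases hvw.adj_sub.2 with h | h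
        · exact outF_cover G v w h
        · exact (outF_cover G w v h).symm
      rw [Finset.mem_coe, Finset.mem_biUnion]
      rcases key with h | h
      · exact ⟨v, by simpa using hvw.fst_mem, Finset.mem_image.2 ⟨w, h, rfl⟩⟩
      · exact ⟨w, by simpa using hvw.snd_mem, Finset.mem_image.2 ⟨v, h, Sym2.eq_swap⟩⟩
  have h1 := Set.ncard_le_ncard hsub (Finset.finite_toSet _)
  rw [Set.ncard_coe_finset] at h1
  have h2 := Finset.card_biUnion_le_card_mul H.verts.toFinset
    (fun v => (outF G v).image fun w => s(v, w)) 10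
    (fun v _ => Finset.card_image_le.trans (outF_card G hdeg v))
  rw [← Set.ncard_eq_toFinset_card'] at h2
  omega
end

section
/- Let G be a finite connected planar simple graph on n vertices with maximum degree at most 4. Then the graph G* is 4-partite, i.e., G* admits a proper 4-coloring. -/
open SimpleGraph

def POn {n : ℕ} (G : SimpleGraph (Fin n)) (c : Fin n → Fin 4) (S : Finset (Fin n)) : Prop :=
  ∀ a ∈ S, ∀ b ∈ S, G.Adj a b → c a ≠ c b

lemma step_ext {n : ℕ} (G : SimpleGraph (Fin n)) [DecidableRel G.Adj]
    (c : Fin n → Fin 4) (S : Finset (Fin n)) (hc : POn G c S) (x : Fin n) (hx : x ∉ S)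
    (h : ((G.neighborFinset x ∩ S).image c).card < 4) :
    ∃ c' : Fin n → Fin 4, (∀ a ∈ S, c' a = c a) ∧ POn G c' (insert x S) := by
  obtain ⟨k, hk⟩ : ∃ k, k ∉ (G.neighborFinset x ∩ S).image c := by
    by_contra hh
    push Not at hh
    rw [Finset.eq_univ_of_forall hh] at h
    simp at h
  have hk' : ∀ b ∈ S, G.Adj x b → c b ≠ k := by
    intro b hb hxb e
    exact hk (Finset.mem_image.2 ⟨b, by simp [hb, hxb], e⟩)
  have hS : ∀ a ∈ S, Function.update c x k a = c a := by
    intro a ha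
    have : a ≠ x := by rintro rfl; exact hx ha
    simp [this]
  refine ⟨Function.update c x k, hS, ?_⟩
  intro a ha b hb hab
  rcases Finset.mem_insert.1 ha with rfl | ha'
  · rcases Finset.mem_insert.1 hb with rfl | hb'
    · exact absurd hab (G.loopless.irrefl _)
    · rw [hS b hb']; simpa using (hk' b hb' hab).symm
  · rcases Finset.mem_insert.1 hb with rfl | hb'
    · rw [hS a ha']; simpa using (hk' a ha' hab.symm)
    · rw [hS a ha', hS b hb']; exact hc a ha' b hb' hab

lemma greedy_ext {n : ℕ} (G : SimpleGraph (Fin n)) [DecidableRel G.Adj]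
    (hdeg : ∀ v, G.degree v ≤ 4) (ρ : Fin n → ℕ) (T : Finset (Fin n)) :
    ∀ (S : Finset (Fin n)) (c : Fin n → Fin 4), POn G c S → (∀ t ∈ T, t ∉ S) →
      (∀ t ∈ T, ∃ t', G.Adj t t' ∧ t' ∉ S ∧ ρ t' < ρ t) →
      ∃ c' : Fin n → Fin 4, (∀ a ∈ S, c' a = c a) ∧ POn G c' (S ∪ T) := by
  induction T using Finset.induction_on_max_value ρ with
  | empty =>
    intro S c hc _ _
    exact ⟨c, fun _ _ => rfl, by simpa using hc⟩
  | insert a s ha hmax ih =>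
    intro S c hc hd ht
    obtain ⟨y, hay, hyS, -⟩ := ht a (by simp)
    obtain ⟨c1, h1, h1'⟩ := step_ext G c S hc a (hd a (by simp)) (by
      have h2 : (G.neighborFinset a ∩ S) ⊆ (G.neighborFinset a).erase y := by
        intro z hz
        simp only [Finset.mem_inter] at hz
        refine Finset.mem_erase.2 ⟨?_, hz.1⟩
        rintro rfl
        exact hyS hz.2
      have h3 := Finset.card_le_card h2
      have hy : y ∈ G.neighborFinset a := by simpa using hay
      have h4 := Finset.card_erase_lt_of_mem hy
      have h5 := hdeg a
      rw [← G.card_neighborFinset_eq_degree] at h5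
      have h6 := Finset.card_image_le (s := G.neighborFinset a ∩ S) (f := c)
      omega)
    obtain ⟨c2, h2, h2'⟩ := ih (insert a S) c1 h1' (by
      intro t ht' hh
      rcases Finset.mem_insert.1 hh with rfl | hh
      · exact ha ht'
      · exact hd t (by simp [ht']) hh) (by
      intro t ht'
      obtain ⟨t', e1, e2, e3⟩ := ht t (by simp [ht'])
      refine ⟨t', e1, ?_, e3⟩
      intro hh
      rcases Finset.mem_insert.1 hh with rfl | hh
      · have := hmax t ht'
        omega
      · exact e2 hh)
    refine ⟨c2, ?_, ?_⟩
    · intro b hb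
      rw [h2 b (by simp [hb]), h1 b hb]
    · have : S ∪ insert a s = insert a S ∪ s := by
        ext z; simp only [Finset.mem_union, Finset.mem_insert]; tauto
      rw [this]; exact h2'

lemma colorable_of_POn {n : ℕ} (G : SimpleGraph (Fin n)) (c : Fin n → Fin 4)
    (h : POn G c Finset.univ) : G.Colorable 4 :=
  ⟨Coloring.mk c (fun {a b} hab => h a (by simp) b (by simp) hab)⟩

/-- Finish: everything but `x` is greedily colourable towards `x`. -/
lemma finish {n : ℕ} (G : SimpleGraph (Fin n)) [DecidableRel G.Adj]
    (hdeg : ∀ v, G.degree v ≤ 4) (ρ : Fin n → ℕ) (S : Finset (Fin n)) (c : Fin n → Fin 4)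
    (hc : POn G c S) (x y z : Fin n) (hx : x ∉ S) (hy : y ∈ S) (hz : z ∈ S) (hyz : y ≠ z)
    (hxy : G.Adj x y) (hxz : G.Adj x z) (hcc : c y = c z)
    (hr : ∀ t, t ∉ S → t ≠ x → ∃ t', G.Adj t t' ∧ t' ∉ S ∧ ρ t' < ρ t) :
    G.Colorable 4 := by
  obtain ⟨c1, h1, h1'⟩ := greedy_ext G hdeg ρ (Finset.univ.filter (fun t => t ∉ S ∧ t ≠ x)) S c hc
    (by intro t ht; simp at ht; exact ht.1)
    (by intro t ht; simp at ht; exact hr t ht.1 ht.2)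
  obtain ⟨c2, -, h2⟩ := step_ext G c1 _ h1' x (by simp [hx]) (by
    generalize (S ∪ Finset.univ.filter (fun t => t ∉ S ∧ t ≠ x)) = U
    have h2 : (G.neighborFinset x ∩ U).image c1 ⊆ ((G.neighborFinset x).erase y).image c1 := by
      intro k hk
      obtain ⟨w, hw, rfl⟩ := Finset.mem_image.1 hk
      simp only [Finset.mem_inter] at hw
      by_cases hwy : w = y
      · subst hwy
        refine Finset.mem_image.2 ⟨z, ?_, ?_⟩
        · simp [hyz.symm, hxz]
        · rw [h1 z hz, h1 w hy, hcc]
      · exact Finset.mem_image.2 ⟨w, Finset.mem_erase.2 ⟨hwy, hw.1⟩, rfl⟩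
    have h3 := Finset.card_le_card h2
    have hy : y ∈ G.neighborFinset x := by simpa using hxy
    have h4 := Finset.card_erase_lt_of_mem hy
    have h5 := hdeg x
    rw [← G.card_neighborFinset_eq_degree] at h5
    have h6 := Finset.card_image_le (s := (G.neighborFinset x).erase y) (f := c1)
    omega)
  refine colorable_of_POn G c2 ?_
  convert h2 using 1
  ext t
  simp
  tauto

lemma color_but_one {n : ℕ} (G : SimpleGraph (Fin n)) [DecidableRel G.Adj]
    (hconn : G.Connected) (hdeg : ∀ v, G.degree v ≤ 4) (x : Fin n) :
    ∃ c, POn G c (Finset.univ.erase x) := by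
  obtain ⟨c, -, h⟩ := greedy_ext G hdeg (fun t => G.dist t x) (Finset.univ.erase x) ∅ (fun _ => 0)
    (by intro a ha; simp at ha) (by simp) (by
      intro t ht
      have htx : t ≠ x := by simpa using ht
      obtain ⟨p, hp⟩ := hconn.exists_walk_length_eq_dist t x
      cases p with
      | nil => exact absurd rfl htx
      | cons hadj q =>
        rename_i v
        refine ⟨v, hadj, by simp, ?_⟩
        have := dist_le q
        simp at hp
        omega)
  exact ⟨c, by simpa using h⟩

lemma exists_P3 {n : ℕ} (G : SimpleGraph (Fin n)) (hconn : G.Connected)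
    (hnc : ¬ ∀ a b, a ≠ b → G.Adj a b) :
    ∃ a b c, G.Adj a b ∧ G.Adj b c ∧ a ≠ c ∧ ¬ G.Adj a c := by
  by_contra hh
  push Not at hh
  apply hnc
  intro a b hab
  obtain ⟨p⟩ := hconn.preconnected a b
  have key : ∀ u v : Fin n, G.Walk u v → u = v ∨ G.Adj u v := by
    intro u v p
    induction p with
    | nil => exact Or.inl rfl
    | cons hadj q ih =>
      rename_i u' v' w'
      rcases ih with rfl | ih
      · exact Or.inr hadj
      · by_cases e : u' = w'
        · exact Or.inl e
        · exact Or.inr (hh _ _ _ hadj ih e)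
  exact (key a b p).resolve_left hab

lemma complete_case {n : ℕ} (G : SimpleGraph (Fin n))
    (hp : ¬ HasMinor G (⊤ : SimpleGraph (Fin 5))) (hc : ∀ a b, a ≠ b → G.Adj a b) :
    G.Colorable 4 := by
  by_cases hn : n ≤ 4
  · exact ⟨Coloring.mk (fun v => Fin.castLE hn v) (fun {a b} hab e =>
      hab.ne (by simpa using e))⟩
  · exfalso
    have hn' : 5 ≤ n := by omega
    apply hp
    refine ⟨fun w => {Fin.castLE hn' w}, ?_, ?_, ?_⟩
    · intro w
      have : Nonempty (({Fin.castLE hn' w} : Set (Fin n))) := ⟨⟨_, rfl⟩⟩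
      have : Subsingleton (({Fin.castLE hn' w} : Set (Fin n))) := inferInstance
      refine ⟨fun a b => ?_⟩
      rw [Subsingleton.elim a b]
    · intro w w' h
      simpa using h
    · intro w w' h
      exact ⟨_, rfl, _, rfl, hc _ _ (by simpa using h)⟩

def IsP {n : ℕ} (G : SimpleGraph (Fin n)) (a b c : Fin n) (r : ℕ) (f : ℕ → Fin n) : Prop :=
  (∀ i ≤ r, ∀ j ≤ r, f i = f j → i = j) ∧ f 0 = a ∧ f 1 = b ∧ f 2 = c ∧
    ∀ i < r, G.Adj (f i) (f (i + 1))

lemma exists_max {n : ℕ} (G : SimpleGraph (Fin n)) (a b c : Fin n) (hab : G.Adj a b)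
    (hbc : G.Adj b c) (hac : a ≠ c) :
    ∃ r f, 2 ≤ r ∧ IsP G a b c r f ∧ ∀ w, G.Adj (f r) w → ∃ i ≤ r, f i = w := by
  classical
  have hP2 : ∃ f, IsP G a b c 2 f := by
    refine ⟨fun i => if i = 0 then a else if i = 1 then b else c, ?_, by simp, by simp, by simp, ?_⟩
    · intro i hi j hj
      have := hab.ne
      have := hbc.ne
      interval_cases i <;> interval_cases j <;> simp_all [Ne.symm]
    · intro i hi
      interval_cases i <;> simp_all
  have hbd : ∀ r f, IsP G a b c r f → r + 1 ≤ n := by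
    intro r f hf
    have : Function.Injective (fun i : Fin (r + 1) => f i) := by
      intro i j hij
      exact Fin.ext (hf.1 i (by omega) j (by omega) hij)
    simpa using Fintype.card_le_of_injective _ this
  by_contra hh
  push Not at hh
  have : ∀ k, ∃ f, IsP G a b c (2 + k) f := by
    intro k
    induction k with
    | zero => exact hP2
    | succ k ih =>
      obtain ⟨f, hf⟩ := ih
      obtain ⟨w, hw, hw'⟩ := hh (2 + k) f (by omega) hf
      obtain ⟨h1, h2, h3, h4, h5⟩ := hf
      refine ⟨Function.update f (2 + k + 1) w, ?_, ?_, ?_, ?_, ?_⟩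
      · intro i hi j hj hij
        by_cases ei : i = 2 + k + 1
        · by_cases ej : j = 2 + k + 1
          · omega
          · rw [ei, Function.update_self, Function.update_of_ne ej] at hij
            exact absurd hij.symm (hw' j (by omega))
        · by_cases ej : j = 2 + k + 1
          · rw [ej, Function.update_self, Function.update_of_ne ei] at hij
            exact absurd hij (hw' i (by omega))
          · rw [Function.update_of_ne ei, Function.update_of_ne ej] at hij
            exact h1 i (by omega) j (by omega) hij
      · rw [Function.update_of_ne (by omega), h2]
      · rw [Function.update_of_ne (by omega), h3]
      · rw [Function.update_of_ne (by omega), h4]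
      · intro i hi
        rw [Function.update_of_ne (by omega)]
        by_cases ei : i = 2 + k
        · rw [ei, Function.update_self]; exact hw
        · rw [Function.update_of_ne (by omega)]; exact h5 i (by omega)
  obtain ⟨f, hf⟩ := this n
  have := hbd _ _ hf
  omega

lemma brooks {n : ℕ} (G : SimpleGraph (Fin n)) [DecidableRel G.Adj]
    (hconn : G.Connected) (hp : ¬ HasMinor G (⊤ : SimpleGraph (Fin 5)))
    (hdeg : ∀ v, G.degree v ≤ 4) : G.Colorable 4 := by
  classical
  by_cases hnc : ∀ a b, a ≠ b → G.Adj a b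
  · exact complete_case G hp hnc
  obtain ⟨a, b, c, hab, hbc, hac, hnac⟩ := exists_P3 G hconn hnc
  obtain ⟨r, f, hr, ⟨hinj, h0, h1, h2, hadj⟩, hmax⟩ := exists_max G a b c hab hbc hac
  obtain ⟨idx, hidx⟩ : ∃ idx : Fin n → ℕ, ∀ i ≤ r, idx (f i) = i := by
    refine ⟨fun v => if h : ∃ i ≤ r, f i = v then h.choose else 0, ?_⟩
    intro i hi
    have h : ∃ i' ≤ r, f i' = f i := ⟨i, hi, rfl⟩
    simp only [h, dif_pos]
    exact hinj _ h.choose_spec.1 _ hi h.choose_spec.2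
  -- smallest neighbour index
  have hex : ∃ j, j < r ∧ G.Adj (f r) (f j) := by
    refine ⟨r - 1, by omega, ?_⟩
    have := hadj (r - 1) (by omega)
    rw [show r - 1 + 1 = r by omega] at this
    exact this.symm
  obtain ⟨j, ⟨hjr, hrj⟩, hjmin⟩ : ∃ j, (j < r ∧ G.Adj (f r) (f j)) ∧
      ∀ i, (i < r ∧ G.Adj (f r) (f i)) → j ≤ i :=
    ⟨Nat.find hex, Nat.find_spec hex, fun i hi => Nat.find_min' hex hi⟩
  let C : Finset (Fin n) := (Finset.Icc j r).image f
  have memC : ∀ v, v ∈ C ↔ ∃ i, j ≤ i ∧ i ≤ r ∧ f i = v := by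
    intro v; simp [C, and_assoc]
  have hrC : ∀ w, G.Adj (f r) w → w ∈ C := by
    intro w hw
    obtain ⟨i, hi, rfl⟩ := hmax w hw
    have : i ≠ r := by rintro rfl; exact G.loopless.irrefl _ hw
    exact (memC _).2 ⟨i, hjmin i ⟨by omega, hw⟩, hi, rfl⟩
  by_cases hout : ∃ k u, j ≤ k ∧ k ≤ r ∧ G.Adj (f k) u ∧ u ∉ C
  · -- cycle case
    obtain ⟨k, hjk, hkr, ⟨u, hku, huC⟩, hk1⟩ : ∃ k, j ≤ k ∧ k < r ∧
        (∃ u, G.Adj (f k) u ∧ u ∉ C) ∧ ∀ w, G.Adj (f (k + 1)) w → w ∈ C := by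
      by_contra hcon
      push Not at hcon
      obtain ⟨k0, u0, e1, e2, e3, e4⟩ := hout
      have : ∀ d, k0 + d ≤ r → ∃ u, G.Adj (f (k0 + d)) u ∧ u ∉ C := by
        intro d
        induction d with
        | zero => intro _; exact ⟨u0, e3, e4⟩
        | succ d ih =>
          intro hd
          obtain ⟨u, hu, hu'⟩ := ih (by omega)
          exact hcon (k0 + d) (by omega) (by omega) ⟨u, hu, hu'⟩
      obtain ⟨u, hu, hu'⟩ := this (r - k0) (by omega)
      rw [show k0 + (r - k0) = r by omega] at hu
      exact hu' (hrC u hu)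
    obtain ⟨c0, hc0⟩ := color_but_one G hconn hdeg (f r)
    have hrmem : f r ∈ C := (memC _).2 ⟨r, by omega, le_rfl, rfl⟩
    have hk1mem : f (k + 1) ∈ C := (memC _).2 ⟨k + 1, by omega, by omega, rfl⟩
    have hS : ∀ v, v ∈ insert (f (k + 1)) (Cᶜ) ↔ v = f (k + 1) ∨ v ∉ C := by
      intro v; simp
    have hne : ∀ v, v ∉ C → v ≠ f (k + 1) := by rintro v hv rfl; exact hv hk1mem
    have hner : ∀ v, v ∉ C → v ≠ f r := by rintro v hv rfl; exact hv hrmem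
    have hmemS : ∀ i, j ≤ i → i ≤ r → i ≠ k + 1 → f i ∉ insert (f (k + 1)) (Cᶜ) := by
      intro i e1 e2 e3 hh
      rcases (hS _).1 hh with hh | hh
      · exact e3 (hinj _ e2 _ (by omega) hh)
      · exact hh ((memC _).2 ⟨i, e1, e2, rfl⟩)
    refine finish G hdeg (fun v => if idx v ≤ k then k - idx v else k + 1 + (r - idx v))
      (insert (f (k + 1)) (Cᶜ)) (Function.update c0 (f (k + 1)) (c0 u)) ?_ (f k) u (f (k + 1))
      (hmemS k hjk (by omega) (by omega)) ((hS _).2 (Or.inr huC)) ((hS _).2 (Or.inl rfl))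
      (hne u huC) hku (hadj k hkr) ?_ ?_
    · intro p hp q hq hpq
      rcases (hS _).1 hp with rfl | hp
      · rcases (hS _).1 hq with rfl | hq
        · exact absurd hpq (G.loopless.irrefl _)
        · exact absurd (hk1 _ hpq) hq
      · rcases (hS _).1 hq with rfl | hq
        · exact absurd (hk1 _ hpq.symm) hp
        · rw [Function.update_of_ne (hne _ hp), Function.update_of_ne (hne _ hq)]
          exact hc0 _ (by simp [hner _ hp]) _ (by simp [hner _ hq]) hpq
    · rw [Function.update_self, Function.update_of_ne (hne _ huC)]
    · intro t ht htk
      have ht' : ¬ (t = f (k + 1) ∨ t ∉ C) := fun h => ht ((hS _).2 h)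
      push Not at ht'
      obtain ⟨i, e1, e2, rfl⟩ := (memC _).1 ht'.2
      have hik : i ≠ k := by rintro rfl; exact htk rfl
      have hik1 : i ≠ k + 1 := by rintro rfl; exact ht'.1 rfl
      by_cases hir : i = r
      · subst hir
        refine ⟨f j, hrj, hmemS j le_rfl (by omega) (by omega), ?_⟩
        simp only [hidx j (by omega), hidx i le_rfl]
        rw [if_pos hjk, if_neg (by omega)]
        omega
      · refine ⟨f (i + 1), hadj i (by omega), hmemS _ (by omega) (by omega) (by omega), ?_⟩
        simp only [hidx i e2, hidx (i + 1) (by omega)]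
        split_ifs <;> omega
  · -- Hamiltonian case
    push Not at hout
    have hall : ∀ v, v ∈ C := by
      have key : ∀ u v : Fin n, G.Walk u v → u ∈ C → v ∈ C := by
        intro u v p
        induction p with
        | nil => exact id
        | cons had q ih =>
          intro hu
          obtain ⟨i, e1, e2, rfl⟩ := (memC _).1 hu
          exact ih (hout i _ e1 e2 had)
      intro v
      obtain ⟨p⟩ := hconn.preconnected (f r) v
      exact key _ _ p ((memC _).2 ⟨r, by omega, le_rfl, rfl⟩)
    have hall' : ∀ v, ∃ i ≤ r, f i = v := by
      intro v
      obtain ⟨i, -, e, e'⟩ := (memC _).1 (hall v)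
      exact ⟨i, e, e'⟩
    by_cases hm : ∃ m, 3 ≤ m ∧ m ≤ r ∧ G.Adj (f 1) (f m)
    · obtain ⟨m, hm3, hmr, hm1⟩ := hm
      subst h0 h1 h2
      have hmemS : ∀ i, i ≤ r → i ≠ 0 → i ≠ 2 → f i ∉ ({f 0, f 2} : Finset (Fin n)) := by
        intro i e1 e2 e3 hh
        simp only [Finset.mem_insert, Finset.mem_singleton] at hh
        rcases hh with hh | hh
        · exact e2 (hinj _ e1 _ (by omega) hh)
        · exact e3 (hinj _ e1 _ (by omega) hh)
      refine finish G hdeg (fun v => if idx v = 1 then 0 else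
          1 + ((idx v - m) + (m - idx v))) {f 0, f 2} (fun _ => 0) ?_ (f 1) (f 0) (f 2)
        (hmemS 1 (by omega) (by omega) (by omega)) (by simp) (by simp) hac hab.symm hbc rfl ?_
      · intro p hp q hq hpq
        simp only [Finset.mem_insert, Finset.mem_singleton] at hp hq
        exfalso
        rcases hp with rfl | rfl <;> rcases hq with rfl | rfl
        · exact G.loopless.irrefl _ hpq
        · exact hnac hpq
        · exact hnac hpq.symm
        · exact G.loopless.irrefl _ hpq
      · intro t ht ht1
        obtain ⟨i, hi, rfl⟩ := hall' t
        have i0 : i ≠ 0 := by rintro rfl; simp at ht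
        have i1 : i ≠ 1 := by rintro rfl; exact ht1 rfl
        have i2 : i ≠ 2 := by rintro rfl; simp at ht
        rcases lt_trichotomy i m with him | him | him
        · refine ⟨f (i + 1), hadj i (by omega), hmemS _ (by omega) (by omega) (by omega), ?_⟩
          simp only [hidx i hi, hidx (i + 1) (by omega)]
          split_ifs <;> omega
        · subst him
          refine ⟨f 1, hm1.symm, hmemS _ (by omega) (by omega) (by omega), ?_⟩
          simp only [hidx i hi, hidx 1 (by omega)]
          split_ifs <;> omega
        · refine ⟨f (i - 1), ?_, hmemS _ (by omega) (by omega) (by omega), ?_⟩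
          · have := hadj (i - 1) (by omega)
            rw [show i - 1 + 1 = i by omega] at this
            exact this.symm
          simp only [hidx i hi, hidx (i - 1) (by omega)]
          split_ifs <;> omega
    · push Not at hm
      obtain ⟨c0, hc0⟩ := color_but_one G hconn hdeg b
      obtain ⟨c1, -, hc1⟩ := step_ext G c0 _ hc0 b (by simp) (by
        have hsub : G.neighborFinset b ∩ Finset.univ.erase b ⊆ {a, c} := by
          intro w hw
          have hw1 : G.Adj b w := by simpa using (Finset.mem_inter.1 hw).1
          obtain ⟨i, hi, rfl⟩ := hall' w
          have : i < 3 := by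
            by_contra h3
            exact hm i (by omega) hi (h1 ▸ hw1)
          have : i ≠ 1 := by rintro rfl; rw [h1] at hw1; exact G.loopless.irrefl _ hw1
          have : i = 0 ∨ i = 2 := by omega
          rcases this with rfl | rfl
          · simp [h0]
          · simp [h2]
        have e1 := Finset.card_le_card hsub
        have e2 : ({a, c} : Finset (Fin n)).card ≤ 2 := Finset.card_le_two
        have e3 := Finset.card_image_le (s := G.neighborFinset b ∩ Finset.univ.erase b) (f := c0)
        omega)
      refine colorable_of_POn G c1 ?_
      rwa [Finset.insert_erase (Finset.mem_univ b)] at hc1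

/-- If `G` is a connected planar graph on `n` vertices with maximum degree at most 4, then
`G*` is 4-partite, i.e. admits a proper 4-coloring. -/
theorem stmt16 {n : ℕ} (G : SimpleGraph (Fin n)) [DecidableRel G.Adj]
    (hconn : G.Connected) (hplanar : IsPlanar G) (hdeg : ∀ v, G.degree v ≤ 4) :
    (GStar G).Colorable 4 := by
  obtain ⟨c⟩ := brooks G hconn hplanar.1 hdeg
  let g : StarV n → Fin 4 := fun v => match v with
    | .orig i => c i
    | .copy i => c i
    | .gx i => if c i = 1 then 1 else 3
    | .ga i _ => if c i = 1 then 2 else 1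
    | .gb _ _ => 0
    | .gy _ => 0
  have hg : ∀ v w, starRel G v w → g v ≠ g w := by
    intro v w h
    rcases v with i | i | i | ⟨i, i'⟩ | ⟨i, i'⟩ | i <;>
      rcases w with j | j | j | ⟨j, j'⟩ | ⟨j, j'⟩ | j <;>
      simp only [starRel] at h <;>
      first
      | exact c.valid h
      | (subst h; simp only [g]; split_ifs <;> simp_all)
      | (simp only [g]; split_ifs <;> simp_all)
  refine ⟨Coloring.mk g (fun {v w} hvw => ?_)⟩
  rw [GStar, SimpleGraph.fromRel_adj] at hvw
  rcases hvw.2 with h | h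
  · exact hg _ _ h
  · exact (hg _ _ h).symm
end
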